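/- arXiv:2201.05485 — 2 statements merged into one kernel-verified Lean document; each statement's English description precedes it below -/
import Mathlib

section
/- Fix q > 0. For every λ > 0, lim_{n→∞} (1/n) log Z_{n,λ,q}[K] = log(1 − e^{−λ}), and the convergence is uniform for λ belonging to compact subsets of (0,∞). -/
open Filter Topology Set

noncomputable section

/-- Size of the connected component of `K_n(ω)` containing the vertex `v`. -/
def compSize {n : ℕ} (G : SimpleGraph (Fin n)) (v : Fin n) : ℕ :=
  (G.connectedComponentMk v).supp.ncard

/-- Random cluster weight of a configuration `G` on the complete graph `K_m`,
with edge weight `p` and cluster weight `q`. -/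
def rcW (m : ℕ) (p q : ℝ) (G : SimpleGraph (Fin m)) : ℝ :=
  p ^ G.edgeSet.ncard * (1 - p) ^ (m * (m - 1) / 2 - G.edgeSet.ncard) *
    q ^ Nat.card G.ConnectedComponent

/-- Total random-cluster weight of an event, with explicit edge weight `p`. -/
def ZP (m : ℕ) (p q : ℝ) (A : Set (SimpleGraph (Fin m))) : ℝ :=
  ∑ᶠ G ∈ A, rcW m p q G

/-- `Z_{n,λ,q}[A]`, i.e. the total weight of the event `A` with `p = λ/n`. -/
def Zrc (n : ℕ) (lam q : ℝ) (A : Set (SimpleGraph (Fin n))) : ℝ :=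
  ZP n (lam / n) q A

/-- The partition function `Z_{n,λ,q}`. -/
def Ztot (n : ℕ) (lam q : ℝ) : ℝ := Zrc n lam q Set.univ

/-- The random cluster probability `φ_{n,λ,q}[A]`. -/
def phiRC (n : ℕ) (lam q : ℝ) (A : Set (SimpleGraph (Fin n))) : ℝ :=
  Zrc n lam q A / Ztot n lam q

/-- The event `K` that the configuration is connected. -/
def Kev (n : ℕ) : Set (SimpleGraph (Fin n)) := {G | G.Connected}

/-- The event `B_r` that no connected component has size larger than `r`. -/
def Bev (n : ℕ) (r : ℝ) : Set (SimpleGraph (Fin n)) :=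
  {G | ∀ v, (compSize G v : ℝ) ≤ r}

/-- The event `L` that the configuration is acyclic. -/
def Lev (n : ℕ) : Set (SimpleGraph (Fin n)) := {G | G.IsAcyclic}

/-- The set `V_r` of vertices lying in components of size larger than `r`. -/
def Vbig {n : ℕ} (G : SimpleGraph (Fin n)) (r : ℝ) : Set (Fin n) :=
  {v | r < (compSize G v : ℝ)}

/-- The number `N_r` of connected components of size larger than `r`. -/
def Nbig {n : ℕ} (G : SimpleGraph (Fin n)) (r : ℝ) : ℕ :=
  {C : G.ConnectedComponent | r < (C.supp.ncard : ℝ)}.ncard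

def pi1 (x : ℝ) : ℝ := 1 - Real.exp (-x)

def Psi (x : ℝ) : ℝ := min (Real.log x - (x - 1/x) / 2) 0

def Sent (θ : ℝ) : ℝ := θ * Real.log θ + (1 - θ) * Real.log (1 - θ)

def Phi (θ lam q : ℝ) : ℝ :=
  -Sent θ + (1 - θ) * Real.log (1 - pi1 (lam * θ)) + θ * Real.log (pi1 (lam * θ)) +
    (1 - θ) * (Psi (lam * (1 - θ) / q) - ((q - 1) / (2 * q)) * (lam * (1 - θ)) + Real.log q)

section Combinatorics

open Finset

variable {V : Type*} [DecidableEq V]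

/-- Every vertex of `U` is linked to `S` inside `S ∪ U` (cut characterisation). -/
def Dlink (E : Finset (Sym2 V)) (S U : Finset V) : Prop :=
  ∀ W ⊆ U, W.Nonempty → ∃ a ∈ S ∪ U, a ∉ W ∧ ∃ b ∈ W, s(a, b) ∈ E

open Classical in
/-- Probability of `Dlink` when the edges of `A` are open independently. -/
def PD (p : ℝ) (A : Finset (Sym2 V)) (S U : Finset V) : ℝ :=
  ∑ E ∈ A.powerset, p ^ #E * (1 - p) ^ (#A - #E) * (if Dlink E S U then 1 else 0)

/-- The edges joining `v` to `U`. -/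
def vstar (v : V) (U : Finset V) : Finset (Sym2 V) := U.image (fun u => s(v, u))

lemma card_vstar (v : V) (U : Finset V) : #(vstar v U) = #U :=
  card_image_of_injective _ (fun a b h => by simpa using Sym2.congr_right.1 h)

lemma mem_vstar (v u : V) (U : Finset V) : s(v, u) ∈ vstar v U ↔ u ∈ U := by
  constructor
  · intro h
    obtain ⟨a, ha, h2⟩ := Finset.mem_image.1 h
    exact Sym2.congr_right.1 h2 ▸ ha
  · exact fun h => Finset.mem_image_of_mem _ h

lemma Dlink_step (E : Finset (Sym2 V)) (S U J : Finset V) (v : V) (hv : v ∈ S)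
    (hvU : v ∉ U) (hJ : J ⊆ U) (hE : Disjoint E (vstar v U)) :
    Dlink (vstar v J ∪ E) S U ↔ Dlink E (S.erase v ∪ J) (U \ J) := by
  have hnot : ∀ u ∈ U, s(v, u) ∉ E := fun u hu h =>
    (Finset.disjoint_left.1 hE h) ((mem_vstar v u U).2 hu)
  constructor
  · intro h W hW hne
    obtain ⟨a, ha, haW, b, hb, hab⟩ := h W (hW.trans Finset.sdiff_subset) hne
    have hbU := hW hb
    rw [Finset.mem_sdiff] at hbU
    have hvb : a ≠ v := by
      rintro rfl
      rcases Finset.mem_union.1 hab with h1 | h1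
      · exact hbU.2 ((mem_vstar _ _ _).1 h1)
      · exact hnot b hbU.1 h1
    have hab' : s(a, b) ∈ E := by
      rcases Finset.mem_union.1 hab with h1 | h1
      · exfalso
        obtain ⟨u, hu, h2⟩ := Finset.mem_image.1 h1
        have h3 : v ∈ s(a, b) := by rw [← h2]; simp
        rcases Sym2.mem_iff.1 h3 with h4 | h4
        · exact hvb h4.symm
        · exact hvU (h4 ▸ hbU.1)
      · exact h1
    refine ⟨a, ?_, haW, b, hb, hab'⟩
    simp only [Finset.mem_union, Finset.mem_erase, Finset.mem_sdiff] at ha ⊢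
    tauto
  · intro h W hW hne
    by_cases hd : ∃ b ∈ W, b ∈ J
    · obtain ⟨b, hb, hbJ⟩ := hd
      exact ⟨v, Finset.mem_union_left _ hv, fun h => hvU (hW h), b, hb,
        Finset.mem_union_left _ ((mem_vstar _ _ _).2 hbJ)⟩
    · push Not at hd
      obtain ⟨a, ha, haW, b, hb, hab⟩ := h W
        (fun b hb => Finset.mem_sdiff.2 ⟨hW hb, hd b hb⟩) hne
      refine ⟨a, ?_, haW, b, hb, Finset.mem_union_right _ hab⟩
      simp only [Finset.mem_union, Finset.mem_erase, Finset.mem_sdiff] at ha ⊢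
      have := @hJ a
      tauto

lemma PD_step (p : ℝ) (A : Finset (Sym2 V)) (S U : Finset V) (v : V) (hv : v ∈ S)
    (hvU : v ∉ U) (hA : vstar v U ⊆ A) :
    PD p A S U = ∑ J ∈ U.powerset, p ^ #J * (1 - p) ^ (#U - #J) *
      PD p (A \ vstar v U) (S.erase v ∪ J) (U \ J) := by
  classical
  simp only [PD, Finset.mul_sum]
  rw [← Finset.sum_product']
  symm
  refine Finset.sum_nbij' (fun x => vstar v x.1 ∪ x.2)
    (fun E => (U.filter (fun u => s(v, u) ∈ E), E \ vstar v U)) ?_ ?_ ?_ ?_ ?_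
  · rintro ⟨J, E⟩ h
    simp only [Finset.mem_product, Finset.mem_powerset] at h ⊢
    exact Finset.union_subset ((Finset.image_subset_image h.1).trans hA) (h.2.trans Finset.sdiff_subset)
  · intro E h
    simp only [Finset.mem_product, Finset.mem_powerset] at h ⊢
    exact ⟨Finset.filter_subset _ _, Finset.sdiff_subset_sdiff h le_rfl⟩
  · rintro ⟨J, E⟩ h
    simp only [Finset.mem_product, Finset.mem_powerset] at h
    have hE : ∀ e ∈ E, e ∉ vstar v U := fun e he => (Finset.mem_sdiff.1 (h.2 he)).2
    ext1
    · ext u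
      simp only [Finset.mem_filter, Finset.mem_union, mem_vstar]
      constructor
      · rintro ⟨h1, h2 | h2⟩
        · exact h2
        · exact absurd ((mem_vstar v u U).2 h1) (hE _ h2)
      · intro h2
        exact ⟨h.1 h2, Or.inl h2⟩
    · ext e
      simp only [Finset.mem_sdiff, Finset.mem_union]
      constructor
      · rintro ⟨h1 | h1, h2⟩
        · exact absurd ((Finset.image_subset_image h.1) h1) h2
        · exact h1
      · intro h1
        exact ⟨Or.inr h1, hE e h1⟩
  · intro E h
    ext e
    simp only [Finset.mem_union, Finset.mem_sdiff]
    constructor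
    · rintro (h1 | h1)
      · obtain ⟨u, hu, rfl⟩ := Finset.mem_image.1 h1
        exact (Finset.mem_filter.1 hu).2
      · exact h1.1
    · intro h1
      by_cases h2 : e ∈ vstar v U
      · left
        obtain ⟨u, hu, rfl⟩ := Finset.mem_image.1 h2
        exact (mem_vstar _ _ _).2 (Finset.mem_filter.2 ⟨hu, h1⟩)
      · exact Or.inr ⟨h1, h2⟩
  · rintro ⟨J, E⟩ h
    simp only [Finset.mem_product, Finset.mem_powerset] at h
    have hE : Disjoint E (vstar v U) :=
      Finset.disjoint_left.2 fun e he => (Finset.mem_sdiff.1 (h.2 he)).2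
    have hE' : Disjoint (vstar v J) E :=
      (hE.mono_right (Finset.image_subset_image h.1)).symm
    have hiff := Dlink_step E S U J v hv hvU h.1 hE
    have hc1 : #(A \ vstar v U) = #A - #U := by
      rw [card_sdiff_of_subset hA, card_vstar]
    have hc2 := Finset.card_le_card h.2
    have hc3 := Finset.card_le_card h.1
    have hc4 := Finset.card_le_card hA
    rw [card_vstar] at hc4
    rw [hc1] at hc2
    have hc5 : #A - (#J + #E) = (#U - #J) + (#A - #U - #E) := by omega
    simp only [hiff]
    rw [Finset.card_union_of_disjoint hE', card_vstar, hc1, hc5, pow_add, pow_add]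
    ring

lemma PD_nonneg (p : ℝ) (h0 : 0 ≤ p) (h1 : p ≤ 1) (A : Finset (Sym2 V)) (S U : Finset V) :
    0 ≤ PD p A S U := by
  have : 0 ≤ 1 - p := by linarith
  unfold PD
  refine Finset.sum_nonneg fun E _ => ?_
  split_ifs <;> positivity

lemma PD_empty_right (p : ℝ) (A : Finset (Sym2 V)) (S : Finset V) : PD p A S ∅ = 1 := by
  have h : ∀ E : Finset (Sym2 V), Dlink E S ∅ := by
    intro E W hW hne
    exact absurd (Finset.subset_empty.1 hW) hne.ne_empty
  simp only [PD, h, if_true, mul_one]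
  rw [Finset.sum_pow_mul_eq_add_pow]
  simp

lemma PD_empty_left (p : ℝ) (A : Finset (Sym2 V)) (U : Finset V) (hU : U.Nonempty) :
    PD p A ∅ U = 0 := by
  have h : ∀ E : Finset (Sym2 V), ¬ Dlink E ∅ U := by
    intro E hE
    obtain ⟨a, ha, haW, -⟩ := hE U le_rfl hU
    simp at ha
    exact haW ha
  simp [PD, h]

/-- First moment of the binomial distribution. -/
lemma sum_card_powerset (a b : ℝ) (U : Finset V) :
    ∑ J ∈ U.powerset, a ^ #J * b ^ (#U - #J) * (#J : ℝ) = #U * a * (a + b) ^ (#U - 1) := by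
  induction U using Finset.induction_on with
  | empty => simp
  | insert u U hu ih =>
    rw [Finset.sum_powerset_insert hu, card_insert_of_notMem hu]
    have e1 : ∑ J ∈ U.powerset, a ^ #J * b ^ (#U + 1 - #J) * (#J : ℝ)
        = b * ∑ J ∈ U.powerset, a ^ #J * b ^ (#U - #J) * (#J : ℝ) := by
      rw [Finset.mul_sum]
      refine Finset.sum_congr rfl fun J hJ => ?_
      have := Finset.card_le_card (Finset.mem_powerset.1 hJ)
      rw [show #U + 1 - #J = (#U - #J) + 1 by omega, pow_succ]
      ring
    have e2 : ∑ J ∈ U.powerset, a ^ #(insert u J) * b ^ (#U + 1 - #(insert u J)) *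
        (#(insert u J) : ℝ)
        = a * ∑ J ∈ U.powerset, a ^ #J * b ^ (#U - #J) * (#J : ℝ)
          + a * ∑ J ∈ U.powerset, a ^ #J * b ^ (#U - #J) := by
      rw [Finset.mul_sum, Finset.mul_sum, ← Finset.sum_add_distrib]
      refine Finset.sum_congr rfl fun J hJ => ?_
      have h1 := Finset.mem_powerset.1 hJ
      rw [card_insert_of_notMem (fun h => hu (h1 h))]
      rw [show #U + 1 - (#J + 1) = #U - #J by omega, pow_succ]
      push_cast
      ring
    rw [e1, e2, ih, Finset.sum_pow_mul_eq_add_pow]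
    rcases Nat.eq_zero_or_pos #U with h | h
    · simp [h]
    · obtain ⟨k, hk⟩ := Nat.exists_eq_succ_of_ne_zero h.ne'
      rw [hk]
      simp only [Nat.succ_eq_add_one, Nat.add_sub_cancel]
      push_cast
      ring

/-- The two-sided bound on the linking probability. -/
lemma PD_bounds (p : ℝ) (h0 : 0 ≤ p) (h1 : p ≤ 1) (k : ℕ) :
    ∀ (A : Finset (Sym2 V)) (S U : Finset V), #S + #U = k → Disjoint S U →
      (∀ a ∈ S ∪ U, ∀ b ∈ U, a ≠ b → s(a, b) ∈ A) →
      PD p A S U ≤ (1 - (1 - p) ^ (k - 1)) ^ #U ∧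
      (#S : ℝ) / k * (1 - (1 - p) ^ (k - 1)) ^ #U ≤ PD p A S U := by
  have hx0 : 0 ≤ 1 - p := by linarith
  have hx1 : 1 - p ≤ 1 := by linarith
  have hR : ∀ j : ℕ, 0 ≤ 1 - (1 - p) ^ j := fun j => by
    have := pow_le_one₀ hx0 hx1 (n := j)
    linarith
  induction k with
  | zero =>
    intro A S U hk _ _
    have hS : #S = 0 := by omega
    have hU : U = ∅ := by rw [← card_eq_zero]; omega
    subst hU
    simp [PD_empty_right, hS]
  | succ N ih =>
    intro A S U hk hSU hA
    rcases U.eq_empty_or_nonempty with rfl | hU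
    · simp only [Finset.card_empty, add_zero] at hk
      simp only [PD_empty_right, hk, Finset.card_empty, pow_zero, mul_one, le_refl, true_and]
      exact div_self_le_one _
    rcases S.eq_empty_or_nonempty with rfl | ⟨v, hv⟩
    · rw [PD_empty_left p A U hU]
      refine ⟨pow_nonneg (hR _) _, by simp⟩
    have hvU : v ∉ U := Finset.disjoint_left.1 hSU hv
    have hstar : vstar v U ⊆ A := by
      intro e he
      obtain ⟨u, hu, rfl⟩ := Finset.mem_image.1 he
      exact hA v (Finset.mem_union_left _ hv) u hu (fun h => hvU (h ▸ hu))
    have hcard : ∀ J ∈ U.powerset, #(S.erase v ∪ J) = #S - 1 + #J ∧ #(U \ J) = #U - #J := by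
      intro J hJ
      have hJ' := Finset.mem_powerset.1 hJ
      refine ⟨?_, card_sdiff_of_subset hJ'⟩
      rw [Finset.card_union_of_disjoint, card_erase_of_mem hv]
      exact (hSU.mono_left (Finset.erase_subset _ _)).mono_right hJ'
    have hSpos : 0 < #S := Finset.card_pos.2 ⟨v, hv⟩
    have hUpos : 0 < #U := Finset.card_pos.2 hU
    have hN : 0 < N := by omega
    have hI : ∀ J ∈ U.powerset, _ := fun J hJ => ih (A \ vstar v U) (S.erase v ∪ J) (U \ J)
      (by
        have := hcard J hJ
        have h3 := Finset.card_le_card (Finset.mem_powerset.1 hJ)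
        omega)
      (by
        have hJ' := Finset.mem_powerset.1 hJ
        rw [Finset.disjoint_union_left]
        exact ⟨(hSU.mono_left (Finset.erase_subset _ _)).mono_right Finset.sdiff_subset, Finset.disjoint_sdiff⟩)
      (by
        intro a ha b hb hab
        have hJ' := fun h : a ∈ J => (Finset.mem_powerset.1 hJ) h
        simp only [Finset.mem_union, Finset.mem_erase, Finset.mem_sdiff] at ha hb
        have hav : a ≠ v := by
          rintro rfl
          tauto
        have hbv : b ≠ v := by
          rintro rfl
          exact hvU hb.1
        refine Finset.mem_sdiff.2 ⟨hA a (by simp only [Finset.mem_union]; tauto) b hb.1 hab, ?_⟩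
        intro h
        obtain ⟨u, hu, h2⟩ := Finset.mem_image.1 h
        have h3 : v ∈ s(a, b) := by rw [← h2]; simp
        rcases Sym2.mem_iff.1 h3 with h4 | h4
        · exact hav h4.symm
        · exact hbv h4.symm)
    rw [PD_step p A S U v hv hvU hstar]
    set x := 1 - p with hx
    set y := x * (1 - x ^ (N - 1)) with hy
    have hpy : p + y = 1 - x ^ N := by
      obtain ⟨M, rfl⟩ := Nat.exists_eq_succ_of_ne_zero hN.ne'
      simp only [hy, Nat.succ_eq_add_one, Nat.add_sub_cancel, pow_succ]
      rw [hx]; ring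
    rw [Nat.add_sub_cancel]
    constructor
    · rw [← hpy, ← Finset.sum_pow_mul_eq_add_pow]
      refine Finset.sum_le_sum fun J hJ => ?_
      have h := (hI J hJ).1
      rw [(hcard J hJ).2] at h
      rw [hy, mul_pow, ← mul_assoc]
      exact mul_le_mul_of_nonneg_left h (by positivity)
    · have hB : 1 - x ^ N ≤ N * p := by
        have := one_add_mul_sub_le_pow (a := x) (by linarith) N
        rw [hx] at this ⊢
        linarith
      have hsum : ∑ J ∈ U.powerset, p ^ #J * y ^ (#U - #J) * (((#S : ℝ) - 1 + #J) / N) ≤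
          ∑ J ∈ U.powerset, p ^ #J * x ^ (#U - #J) *
            PD p (A \ vstar v U) (S.erase v ∪ J) (U \ J) := by
        refine Finset.sum_le_sum fun J hJ => ?_
        have h := (hI J hJ).2
        rw [(hcard J hJ).2, (hcard J hJ).1, Nat.cast_add, Nat.cast_sub hSpos] at h
        calc _ = p ^ #J * x ^ (#U - #J) * (((#S : ℝ) - 1 + #J) / N *
              (1 - x ^ (N - 1)) ^ (#U - #J)) := by rw [hy, mul_pow]; ring
          _ ≤ _ := by
            refine mul_le_mul_of_nonneg_left ?_ (by positivity)
            simpa using h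
      refine le_trans ?_ hsum
      have hs1 : ∑ J ∈ U.powerset, p ^ #J * y ^ (#U - #J) * (((#S : ℝ) - 1 + #J) / N)
          = (((#S : ℝ) - 1) * (1 - x ^ N) ^ #U + #U * p * (1 - x ^ N) ^ (#U - 1)) / N := by
        rw [← hpy, ← sum_card_powerset, ← Finset.sum_pow_mul_eq_add_pow, Finset.mul_sum,
          ← Finset.sum_add_distrib, Finset.sum_div]
        refine Finset.sum_congr rfl fun J _ => ?_
        ring
      rw [hs1]
      have hR' := hR N
      set R := 1 - x ^ N with hRdef
      have hNr : (0:ℝ) < N := by exact_mod_cast hN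
      have hk' : (#S : ℝ) + #U = N + 1 := by exact_mod_cast hk
      have hS1 : (1:ℝ) ≤ #S := by exact_mod_cast hSpos
      have hU1 : (1:ℝ) ≤ #U := by exact_mod_cast hUpos
      obtain ⟨m, hm⟩ := Nat.exists_eq_succ_of_ne_zero hUpos.ne'
      have hm' : #U - 1 = m := by omega
      rw [hm']
      have hpow : R ^ #U = R ^ m * R := by rw [hm, Nat.succ_eq_add_one, pow_succ]
      have hQ : 0 ≤ R ^ m := pow_nonneg hR' m
      have hstep : (#U : ℝ) / N * (R ^ m * R) ≤ #U * p * R ^ m := by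
        rw [div_mul_eq_mul_div, div_le_iff₀ hNr]
        have : (#U : ℝ) * R ^ m * R ≤ #U * R ^ m * (N * p) :=
          mul_le_mul_of_nonneg_left hB (mul_nonneg (Nat.cast_nonneg _) hQ)
        linarith
      rw [hpow]
      have hcoef : (#S : ℝ) / ((N + 1 : ℕ) : ℝ) ≤ ((#S : ℝ) - 1 + #U / N) / N := by
        push_cast
        have e : ((#S : ℝ) - 1 + #U / N) / N = (((#S : ℝ) - 1) * N + #U) / (N * N) := by
          field_simp
        rw [e, div_le_div_iff₀ (by positivity) (by positivity)]
        have : (#U : ℝ) = N + 1 - #S := by linarith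
        rw [this]
        nlinarith
      calc _ ≤ ((#S : ℝ) - 1 + #U / N) / N * (R ^ m * R) :=
            mul_le_mul_of_nonneg_right hcoef (by positivity)
        _ = (((#S : ℝ) - 1) * (R ^ m * R) + #U / N * (R ^ m * R)) / N := by ring
        _ ≤ _ := div_le_div_of_nonneg_right (by linarith) hNr.le

end Combinatorics

/-- Connectedness as linking to a fixed vertex. -/
lemma connected_iff_Dlink {n : ℕ} (G : SimpleGraph (Fin n)) (v : Fin n)
    (E : Finset (Sym2 (Fin n))) (hE : (E : Set (Sym2 (Fin n))) = G.edgeSet) :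
    G.Connected ↔ Dlink E {v} (Finset.univ.erase v) := by
  classical
  have hadj : ∀ a b, s(a, b) ∈ E ↔ G.Adj a b := by
    intro a b
    rw [← SimpleGraph.mem_edgeSet, ← hE, Finset.mem_coe]
  constructor
  · intro h W hW ⟨w, hw⟩
    by_contra hcon
    push Not at hcon
    have hvW : v ∉ W := fun h => by simpa using hW h
    have key : ∀ a u, G.Walk a u → a ∉ W → u ∉ W := by
      intro a u c
      induction c with
      | nil => exact id
      | @cons a b c hab _ ihc =>
        intro ha
        refine ihc fun hb => ?_
        refine hcon a ?_ ha b hb ((hadj a b).2 hab)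
        by_cases h : a = v <;> simp [h]
    obtain ⟨c⟩ := h.preconnected v w
    exact key v w c hvW hw
  · intro h
    rw [SimpleGraph.connected_iff_exists_forall_reachable]
    refine ⟨v, ?_⟩
    by_contra hcon
    push Not at hcon
    obtain ⟨w, hw⟩ := hcon
    obtain ⟨a, -, haW, b, hb, hab⟩ := h (Finset.univ.filter (fun u => ¬ G.Reachable v u))
      (by
        intro u hu
        rw [Finset.mem_filter] at hu
        refine Finset.mem_erase.2 ⟨?_, Finset.mem_univ _⟩
        rintro rfl
        exact hu.2 (SimpleGraph.Reachable.refl _)) ⟨w, by simpa using hw⟩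
    simp only [Finset.mem_filter, Finset.mem_univ, true_and, not_not] at haW hb
    exact hb (haW.trans ((hadj a b).1 hab).reachable)

/-- The weight of the connected configurations in terms of `PD`. -/
lemma Zrc_eq (n : ℕ) (lam q : ℝ) (v : Fin n) :
    Zrc n lam q (Kev n) = q * PD (lam / n) (⊤ : SimpleGraph (Fin n)).edgeFinset {v}
      (Finset.univ.erase v) := by
  classical
  have : Fintype (SimpleGraph (Fin n)) := Fintype.ofFinite _
  unfold Zrc ZP PD
  rw [finsum_mem_def, finsum_eq_sum_of_fintype, Finset.mul_sum]
  refine Finset.sum_nbij' (fun G => G.edgeFinset) (fun E => SimpleGraph.fromEdgeSet (E : Set _))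
    ?_ ?_ ?_ ?_ ?_
  · intro G _
    rw [Finset.mem_powerset]
    exact SimpleGraph.edgeFinset_mono le_top
  · intro E _
    exact Finset.mem_univ _
  · intro G _
    simp
  · intro E hE
    rw [Finset.mem_powerset] at hE
    apply Finset.coe_injective
    rw [SimpleGraph.coe_edgeFinset, SimpleGraph.edgeSet_fromEdgeSet]
    ext e
    constructor
    · exact fun h => h.1
    · intro h
      refine ⟨h, ?_⟩
      have := hE h
      simpa using this
  · intro G _
    have hiff := connected_iff_Dlink G v G.edgeFinset (SimpleGraph.coe_edgeFinset G)
    have hcard : (⊤ : SimpleGraph (Fin n)).edgeFinset.card = n * (n - 1) / 2 := by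
      rw [SimpleGraph.card_edgeFinset_top_eq_card_choose_two, Fintype.card_fin,
        Nat.choose_two_right]
    have hnc : G.edgeSet.ncard = G.edgeFinset.card := by
      rw [Set.ncard_eq_toFinset_card']
      rfl
    by_cases hc : G.Connected
    · rw [Set.indicator_of_mem (show G ∈ Kev n from hc), if_pos (hiff.1 hc), rcW, hcard, hnc]
      have : Nat.card G.ConnectedComponent = 1 := by
        rw [Nat.card_eq_one_iff_unique]
        have := hc.nonempty
        exact ⟨hc.preconnected.subsingleton_connectedComponent, inferInstance⟩
      rw [this]
      ring
    · rw [Set.indicator_of_notMem (show G ∉ Kev n from hc), if_neg (fun h => hc (hiff.2 h))]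
      ring

lemma Zrc_bounds (n : ℕ) (hn : 0 < n) (lam q : ℝ) (hq : 0 < q) (h0 : 0 ≤ lam) (h1 : lam ≤ n) :
    Zrc n lam q (Kev n) ≤ q * (1 - (1 - lam / n) ^ (n - 1)) ^ (n - 1) ∧
    q * (1 / n * (1 - (1 - lam / n) ^ (n - 1)) ^ (n - 1)) ≤ Zrc n lam q (Kev n) := by
  have hn' : (0:ℝ) < n := by exact_mod_cast hn
  rw [Zrc_eq n lam q ⟨0, hn⟩]
  have h := PD_bounds (lam / n) (by positivity) ((div_le_one hn').2 h1) n
    (⊤ : SimpleGraph (Fin n)).edgeFinset {⟨0, hn⟩} (Finset.univ.erase ⟨0, hn⟩)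
    (by
      rw [Finset.card_erase_of_mem (Finset.mem_univ _)]
      simp
      omega) (by simp)
    (by
      intro a _ b _ hab
      simpa using hab)
  rw [Finset.card_erase_of_mem (Finset.mem_univ _)] at h
  simp only [Finset.card_univ, Fintype.card_fin, Finset.card_singleton, Nat.cast_one] at h
  exact ⟨mul_le_mul_of_nonneg_left h.1 hq.le, mul_le_mul_of_nonneg_left h.2 hq.le⟩

/-- The continuous-convergence core. -/
lemma main_tendsto (q : ℝ) (hq : 0 < q) (l : ℝ) (hl : 0 < l) :
    Tendsto (fun x : ℕ × ℝ => (1 / (x.1 : ℝ)) * Real.log (Zrc x.1 x.2 q (Kev x.1)))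
      (atTop ×ˢ 𝓝 l) (𝓝 (Real.log (1 - Real.exp (-l)))) := by
  have hn : Tendsto (fun x : ℕ × ℝ => (x.1 : ℝ)) (atTop ×ˢ 𝓝 l) atTop :=
    tendsto_natCast_atTop_atTop.comp tendsto_fst
  have hlam : Tendsto (fun x : ℕ × ℝ => x.2) (atTop ×ˢ 𝓝 l) (𝓝 l) := tendsto_snd
  have hinv : Tendsto (fun x : ℕ × ℝ => (x.1 : ℝ)⁻¹) (atTop ×ˢ 𝓝 l) (𝓝 0) :=
    tendsto_inv_atTop_zero.comp hn
  have hdiv : Tendsto (fun x : ℕ × ℝ => x.2 / (x.1 : ℝ)) (atTop ×ˢ 𝓝 l) (𝓝 0) := by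
    simpa [div_eq_mul_inv] using hlam.mul hinv
  have hlogn : Tendsto (fun x : ℕ × ℝ => (x.1 : ℝ)⁻¹ * Real.log x.1) (atTop ×ˢ 𝓝 l) (𝓝 0) := by
    have h := (Real.isLittleO_log_id_atTop.tendsto_div_nhds_zero).comp hn
    refine h.congr fun x => ?_
    simp [div_eq_inv_mul]
  have hratio : Tendsto (fun x : ℕ × ℝ => 1 - (x.1 : ℝ)⁻¹) (atTop ×ˢ 𝓝 l) (𝓝 1) := by
    simpa using hinv.const_sub 1
  have hlt : ∀ᶠ x : ℕ × ℝ in atTop ×ˢ 𝓝 l, x.2 / (x.1 : ℝ) < 1 :=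
    hdiv.eventually_lt_const one_pos
  have hpos : ∀ᶠ x : ℕ × ℝ in atTop ×ˢ 𝓝 l, 0 < x.2 := hlam.eventually_const_lt hl
  have hge : ∀ᶠ x : ℕ × ℝ in atTop ×ˢ 𝓝 l, 2 ≤ (x.1 : ℝ) := hn.eventually_ge_atTop 2
  -- the exponent
  have ht : Tendsto (fun x : ℕ × ℝ => -(((x.1 : ℝ) - 1) * Real.log (1 - x.2 / x.1)))
      (atTop ×ˢ 𝓝 l) (𝓝 l) := by
    have hlo : Tendsto (fun x : ℕ × ℝ => (1 - (x.1 : ℝ)⁻¹) * x.2) (atTop ×ˢ 𝓝 l) (𝓝 l) := by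
      simpa using hratio.mul hlam
    have hup : Tendsto (fun x : ℕ × ℝ => (1 - (x.1 : ℝ)⁻¹) * x.2 * (1 - x.2 / x.1)⁻¹)
        (atTop ×ˢ 𝓝 l) (𝓝 l) := by
      have h1 : Tendsto (fun x : ℕ × ℝ => (1 - x.2 / (x.1 : ℝ))⁻¹) (atTop ×ˢ 𝓝 l) (𝓝 1) := by
        simpa using (hdiv.const_sub 1).inv₀ (by norm_num)
      simpa using hlo.mul h1
    refine tendsto_of_tendsto_of_tendsto_of_le_of_le' hlo hup ?_ ?_
    · filter_upwards [hlt, hpos, hge] with x h1 h2 h3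
      have h4 : 0 < 1 - x.2 / (x.1 : ℝ) := by linarith
      have h5 := Real.log_le_sub_one_of_pos h4
      have h6 : (0:ℝ) < x.1 := by linarith
      have e : (1 - (x.1 : ℝ)⁻¹) * x.2 = ((x.1 : ℝ) - 1) * (x.2 / x.1) := by
        field_simp
      rw [e]
      have : ((x.1 : ℝ) - 1) * Real.log (1 - x.2 / x.1) ≤ ((x.1 : ℝ) - 1) * (-(x.2 / x.1)) :=
        mul_le_mul_of_nonneg_left (by linarith) (by linarith)
      linarith
    · filter_upwards [hlt, hpos, hge] with x h1 h2 h3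
      have h4 : 0 < 1 - x.2 / (x.1 : ℝ) := by linarith
      have h5 := Real.one_sub_inv_le_log_of_pos h4
      have h6 : (0:ℝ) < x.1 := by linarith
      have e : (1 - (x.1 : ℝ)⁻¹) * x.2 * (1 - x.2 / x.1)⁻¹
          = ((x.1 : ℝ) - 1) * ((1 - x.2 / x.1)⁻¹ - 1) := by
        have e1 : (1 - x.2 / (x.1:ℝ))⁻¹ - 1 = (x.2 / x.1) * (1 - x.2 / x.1)⁻¹ := by
          have := mul_inv_cancel₀ h4.ne'
          linear_combination this
        rw [e1]
        have e2 : (1 - (x.1 : ℝ)⁻¹) * x.2 = ((x.1 : ℝ) - 1) * (x.2 / x.1) := by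
          field_simp
        rw [e2]
        ring
      rw [e]
      have : ((x.1 : ℝ) - 1) * (1 - (1 - x.2 / x.1)⁻¹) ≤
          ((x.1 : ℝ) - 1) * Real.log (1 - x.2 / x.1) :=
        mul_le_mul_of_nonneg_left h5 (by linarith)
      linarith
  have hRpos : 0 < 1 - Real.exp (-l) := by
    have : Real.exp (-l) < 1 := by
      rw [← Real.exp_zero]
      exact Real.exp_lt_exp.2 (by linarith)
    linarith
  have hR : Tendsto (fun x : ℕ × ℝ => 1 - (1 - x.2 / (x.1 : ℝ)) ^ (x.1 - 1))
      (atTop ×ˢ 𝓝 l) (𝓝 (1 - Real.exp (-l))) := by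
    refine (((Real.continuous_exp.tendsto _).comp ht.neg).const_sub 1).congr' ?_
    filter_upwards [hlt, hge] with x h1 h3
    have h4 : 0 < 1 - x.2 / (x.1 : ℝ) := by linarith
    have h5 : 1 ≤ x.1 := by
      have : (1:ℝ) ≤ x.1 := by linarith
      exact_mod_cast this
    simp only [Function.comp, neg_neg]
    congr 1
    rw [show ((x.1 : ℝ) - 1) = ((x.1 - 1 : ℕ) : ℝ) by push_cast [h5]; ring,
      Real.exp_nat_mul, Real.exp_log h4]
  have hRev : ∀ᶠ x : ℕ × ℝ in atTop ×ˢ 𝓝 l, 0 < 1 - (1 - x.2 / (x.1 : ℝ)) ^ (x.1 - 1) :=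
    hR.eventually_const_lt hRpos
  have hlogR : Tendsto (fun x : ℕ × ℝ => (1 - (x.1 : ℝ)⁻¹) *
      Real.log (1 - (1 - x.2 / (x.1 : ℝ)) ^ (x.1 - 1)))
      (atTop ×ˢ 𝓝 l) (𝓝 (Real.log (1 - Real.exp (-l)))) := by
    simpa using hratio.mul (hR.log hRpos.ne')
  have hup : Tendsto (fun x : ℕ × ℝ => (x.1 : ℝ)⁻¹ * Real.log q + (1 - (x.1 : ℝ)⁻¹) *
      Real.log (1 - (1 - x.2 / (x.1 : ℝ)) ^ (x.1 - 1)))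
      (atTop ×ˢ 𝓝 l) (𝓝 (Real.log (1 - Real.exp (-l)))) := by
    simpa using (hinv.mul_const (Real.log q)).add hlogR
  have hlo : Tendsto (fun x : ℕ × ℝ => (x.1 : ℝ)⁻¹ * Real.log q + (1 - (x.1 : ℝ)⁻¹) *
      Real.log (1 - (1 - x.2 / (x.1 : ℝ)) ^ (x.1 - 1)) - (x.1 : ℝ)⁻¹ * Real.log x.1)
      (atTop ×ˢ 𝓝 l) (𝓝 (Real.log (1 - Real.exp (-l)))) := by
    simpa using hup.sub hlogn
  have hall : ∀ᶠ x : ℕ × ℝ in atTop ×ˢ 𝓝 l,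
      (x.1 : ℝ)⁻¹ * Real.log q + (1 - (x.1 : ℝ)⁻¹) *
        Real.log (1 - (1 - x.2 / (x.1 : ℝ)) ^ (x.1 - 1)) - (x.1 : ℝ)⁻¹ * Real.log x.1
        ≤ (1 / (x.1 : ℝ)) * Real.log (Zrc x.1 x.2 q (Kev x.1)) ∧
      (1 / (x.1 : ℝ)) * Real.log (Zrc x.1 x.2 q (Kev x.1)) ≤
      (x.1 : ℝ)⁻¹ * Real.log q + (1 - (x.1 : ℝ)⁻¹) *
        Real.log (1 - (1 - x.2 / (x.1 : ℝ)) ^ (x.1 - 1)) := by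
    filter_upwards [hlt, hpos, hge, hRev] with x h1 h2 h3 h4
    have h6 : (0:ℝ) < x.1 := by linarith
    have h7 : 1 ≤ x.1 := by
      have : (1:ℝ) ≤ x.1 := by linarith
      exact_mod_cast this
    obtain ⟨hu, hd⟩ := Zrc_bounds x.1 h7 x.2 q hq h2.le ((div_lt_one h6).1 h1).le
    set R := 1 - (1 - x.2 / (x.1 : ℝ)) ^ (x.1 - 1) with hRd
    have hcast : ((x.1 - 1 : ℕ) : ℝ) = (x.1 : ℝ) - 1 := by push_cast [h7]; ring
    have hlow : 0 < q * (1 / (x.1 : ℝ) * R ^ (x.1 - 1)) := by positivity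
    have hZ : 0 < Zrc x.1 x.2 q (Kev x.1) := lt_of_lt_of_le hlow hd
    have lu := Real.log_le_log hZ hu
    have ld := Real.log_le_log hlow hd
    have hRp : R ^ (x.1 - 1) ≠ 0 := by positivity
    rw [Real.log_mul hq.ne' hRp, Real.log_pow, hcast] at lu
    rw [Real.log_mul hq.ne' (by positivity), Real.log_mul (by positivity) hRp, Real.log_pow,
      hcast, one_div, Real.log_inv] at ld
    have hi : (x.1 : ℝ)⁻¹ * x.1 = 1 := inv_mul_cancel₀ h6.ne'
    have hi0 : 0 ≤ (x.1 : ℝ)⁻¹ := by positivity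
    rw [one_div]
    have lu' := mul_le_mul_of_nonneg_left lu hi0
    have ld' := mul_le_mul_of_nonneg_left ld hi0
    constructor
    · refine le_trans (le_of_eq ?_) ld'
      linear_combination (-Real.log R) * hi
    · refine le_trans lu' (le_of_eq ?_)
      linear_combination (Real.log R) * hi
  exact tendsto_of_tendsto_of_tendsto_of_le_of_le' hlo hup
    (hall.mono fun _ h => h.1) (hall.mono fun _ h => h.2)

/-- Fix `q > 0`. For every `λ > 0`,
`lim_{n→∞} (1/n) log Z_{n,λ,q}[K] = log(1 − e^{−λ})`, and the convergence is
uniform for `λ` belonging to compact subsets of `(0,∞)`. -/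
theorem stmt2 (q : ℝ) (hq : 0 < q) :
    (∀ lam : ℝ, 0 < lam →
      Tendsto (fun n : ℕ => (1 / (n:ℝ)) * Real.log (Zrc n lam q (Kev n))) atTop
        (𝓝 (Real.log (1 - Real.exp (-lam))))) ∧
    ∀ C : Set ℝ, IsCompact C → C ⊆ Set.Ioi (0:ℝ) →
      TendstoUniformlyOn
        (fun (n : ℕ) (lam : ℝ) => (1 / (n:ℝ)) * Real.log (Zrc n lam q (Kev n)))
        (fun lam => Real.log (1 - Real.exp (-lam))) atTop C := by
  have hU : ∀ C : Set ℝ, IsCompact C → C ⊆ Set.Ioi (0:ℝ) →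
      TendstoUniformlyOn
        (fun (n : ℕ) (lam : ℝ) => (1 / (n:ℝ)) * Real.log (Zrc n lam q (Kev n)))
        (fun lam => Real.log (1 - Real.exp (-lam))) atTop C := by
    intro C hC hsub
    refine (tendstoLocallyUniformlyOn_iff_forall_isCompact isOpen_Ioi).1 ?_ C hsub hC
    rw [tendstoLocallyUniformlyOn_iff_filter]
    intro l hl
    have hl' : 0 < l := hl
    rw [tendstoUniformlyOnFilter_iff_tendsto]
    have hRpos : 1 - Real.exp (-l) ≠ 0 := by
      have : Real.exp (-l) < 1 := by
        rw [← Real.exp_zero]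
        exact Real.exp_lt_exp.2 (by linarith)
      exact (by linarith : 0 < 1 - Real.exp (-l)).ne'
    have hf : Tendsto (fun x : ℕ × ℝ => Real.log (1 - Real.exp (-x.2))) (atTop ×ˢ 𝓝 l)
        (𝓝 (Real.log (1 - Real.exp (-l)))) := by
      have h2 : Tendsto (fun x : ℕ × ℝ => x.2) (atTop ×ˢ 𝓝 l) (𝓝 l) := tendsto_snd
      exact (((Real.continuous_exp.tendsto _).comp h2.neg).const_sub 1).log hRpos
    have h := (hf.prodMk_nhds (main_tendsto q hq l hl')).mono_right (nhds_le_uniformity _)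
    exact h.mono_left (Filter.prod_mono le_rfl nhdsWithin_le_nhds)
  refine ⟨fun lam hlam => ?_, hU⟩
  exact (hU {lam} isCompact_singleton (by simpa using hlam)).tendsto_at (Set.mem_singleton lam)
end
end

section
/- Fix q > 0 and λ > 0 with λ ≠ q. Then lim_{r→∞} liminf_{n→∞} (1/n) log Z_{n,λ,q}[B_r] = lim_{r→∞} limsup_{n→∞} (1/n) log Z_{n,λ,q}[B_r] = lim_{n→∞} (1/n) log Z_{n,λ,q}[L] = Ψ(λ/q) − ((q−1)/(2q))λ + log q, and the convergence is uniform for λ belonging to compact subsets of (0,∞)∖{q}. -/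
open Filter Topology Set

noncomputable section

namespace RC
open SimpleGraph

variable {A B V W : Type*}

lemma sum_reach_inl {G : SimpleGraph A} {H : SimpleGraph B} {a a' : A} :
    (G ⊕g H).Reachable (Sum.inl a) (Sum.inl a') ↔ G.Reachable a a' := by
  constructor
  · rintro ⟨p⟩
    have key : ∀ (x y : A ⊕ B) (p : (G ⊕g H).Walk x y), ∀ a, x = Sum.inl a →
        ∃ a', y = Sum.inl a' ∧ G.Reachable a a' := by
      intro x y p
      induction p with
      | nil => intro a h; exact ⟨a, h, Reachable.refl _⟩
      | cons h p ih =>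
        intro a hx
        subst hx
        rename_i v w
        cases v with
        | inl v =>
          obtain ⟨a', h1, h2⟩ := ih v rfl
          exact ⟨a', h1, (Adj.reachable (by simpa using h)).trans h2⟩
        | inr v => simp at h
    obtain ⟨a'', h1, h2⟩ := key _ _ p a rfl
    cases h1; exact h2
  · intro h
    exact h.map (Embedding.sumInl (G := G) (H := H)).toHom

lemma sum_reach_inr {G : SimpleGraph A} {H : SimpleGraph B} {a a' : B} :
    (G ⊕g H).Reachable (Sum.inr a) (Sum.inr a') ↔ H.Reachable a a' := by
  rw [← sum_reach_inl (G := H) (H := G)]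
  exact (Iso.reachable_iff (φ := Iso.sumComm (G := G) (H := H))).symm

lemma sum_acyclic {G : SimpleGraph A} {H : SimpleGraph B} :
    (G ⊕g H).IsAcyclic ↔ G.IsAcyclic ∧ H.IsAcyclic := by
  constructor
  · intro h
    exact ⟨h.embedding Embedding.sumInl, h.embedding Embedding.sumInr⟩
  · rintro ⟨hG, hH⟩
    rw [isAcyclic_iff_forall_adj_isBridge] at *
    rintro (v | v) (w | w) hvw
    · have := hG (by simpa using hvw : G.Adj v w)
      rw [isBridge_iff] at *
      intro hr
      apply this
      rw [← sum_reach_inl (H := H)]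
      refine hr.mono ?_
      rintro (x | x) (y | y) <;> simp
    · simp at hvw
    · simp at hvw
    · have := hH (by simpa using hvw : H.Adj v w)
      rw [isBridge_iff] at *
      intro hr
      apply this
      rw [← sum_reach_inr (G := G)]
      refine hr.mono ?_
      rintro (x | x) (y | y) <;> simp

lemma sum_supp_inl {G : SimpleGraph A} {H : SimpleGraph B} (a : A) :
    ((G ⊕g H).connectedComponentMk (Sum.inl a)).supp =
      Sum.inl '' (G.connectedComponentMk a).supp := by
  ext x
  rcases x with x | x
  · simp [ConnectedComponent.mem_supp_iff, ConnectedComponent.eq, sum_reach_inl]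
  · simp only [ConnectedComponent.mem_supp_iff, ConnectedComponent.eq]
    simp
    intro h
    exact not_reachable_sum_inl_inr _ _ h.symm

lemma sum_supp_inr {G : SimpleGraph A} {H : SimpleGraph B} (a : B) :
    ((G ⊕g H).connectedComponentMk (Sum.inr a)).supp =
      Sum.inr '' (H.connectedComponentMk a).supp := by
  ext x
  rcases x with x | x
  · simp only [ConnectedComponent.mem_supp_iff, ConnectedComponent.eq]
    simp
    intro h
    exact not_reachable_sum_inl_inr _ _ h
  · simp [ConnectedComponent.mem_supp_iff, ConnectedComponent.eq, sum_reach_inr]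

lemma sum_edges [Finite A] [Finite B] (G : SimpleGraph A) (H : SimpleGraph B) :
    (G ⊕g H).edgeSet.ncard = G.edgeSet.ncard + H.edgeSet.ncard := by
  rw [← Nat.card_coe_set_eq, Nat.card_congr edgeSetSumEquiv, Nat.card_sum,
    Nat.card_coe_set_eq, Nat.card_coe_set_eq]

lemma sum_comps [Finite A] [Finite B] (G : SimpleGraph A) (H : SimpleGraph B) :
    Nat.card (G ⊕g H).ConnectedComponent =
      Nat.card G.ConnectedComponent + Nat.card H.ConnectedComponent := by
  rw [← Nat.card_sum]
  symm
  apply Nat.card_eq_of_bijective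
    (Sum.elim (fun C => C.map (Embedding.sumInl (G := G) (H := H)).toHom)
      (fun C => C.map (Embedding.sumInr (G := G) (H := H)).toHom))
  constructor
  · rintro (x | x) (y | y)
    · refine ConnectedComponent.ind₂ (fun x y => ?_) x y
      intro h
      simp only [Sum.elim_inl, ConnectedComponent.map_mk, ConnectedComponent.eq] at h
      have := sum_reach_inl.1 h
      simpa using this
    · refine ConnectedComponent.ind (fun x => ?_) x
      refine ConnectedComponent.ind (fun y => ?_) y
      intro h
      simp only [Sum.elim_inl, Sum.elim_inr, ConnectedComponent.map_mk, ConnectedComponent.eq] at h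
      exact absurd h (not_reachable_sum_inl_inr _ _)
    · refine ConnectedComponent.ind (fun x => ?_) x
      refine ConnectedComponent.ind (fun y => ?_) y
      intro h
      simp only [Sum.elim_inl, Sum.elim_inr, ConnectedComponent.map_mk, ConnectedComponent.eq] at h
      exact absurd h.symm (not_reachable_sum_inl_inr _ _)
    · refine ConnectedComponent.ind₂ (fun x y => ?_) x y
      intro h
      simp only [Sum.elim_inr, ConnectedComponent.map_mk, ConnectedComponent.eq] at h
      have := sum_reach_inr.1 h
      simpa using this
  · intro C
    refine ConnectedComponent.ind (fun x => ?_) C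
    rcases x with x | x
    · exact ⟨Sum.inl (G.connectedComponentMk x), rfl⟩
    · exact ⟨Sum.inr (H.connectedComponentMk x), rfl⟩

end RC

namespace RC
open SimpleGraph

variable {A B V W : Type*}

open Classical in
/-- Glue a graph on `S` and a graph on the complement. -/
def glue (S : Set V) (T : SimpleGraph S) (F : SimpleGraph (Sᶜ : Set V)) : SimpleGraph V :=
  (T ⊕g F).comap (Equiv.Set.sumCompl S).symm

open Classical in
def glueIso (S : Set V) (T : SimpleGraph S) (F : SimpleGraph (Sᶜ : Set V)) :
    glue S T F ≃g (T ⊕g F) := Iso.comap (Equiv.Set.sumCompl S).symm (T ⊕g F)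

lemma glueIso_mem (S : Set V) (T : SimpleGraph S) (F : SimpleGraph (Sᶜ : Set V)) {v : V}
    (h : v ∈ S) : glueIso S T F v = Sum.inl ⟨v, h⟩ := by
  classical exact Equiv.Set.sumCompl_symm_apply_of_mem h

lemma glueIso_notMem (S : Set V) (T : SimpleGraph S) (F : SimpleGraph (Sᶜ : Set V)) {v : V}
    (h : v ∉ S) : glueIso S T F v = Sum.inr ⟨v, h⟩ := by
  classical exact Equiv.Set.sumCompl_symm_apply_of_notMem h

lemma glueIso_adj (S : Set V) (T : SimpleGraph S) (F : SimpleGraph (Sᶜ : Set V)) {v w : V} :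
    (glue S T F).Adj v w ↔ (T ⊕g F).Adj (glueIso S T F v) (glueIso S T F w) :=
  (glueIso S T F).map_adj_iff.symm

lemma glue_induce (S : Set V) (T : SimpleGraph S) (F : SimpleGraph (Sᶜ : Set V)) :
    (glue S T F).induce S = T := by
  ext ⟨v, hv⟩ ⟨w, hw⟩
  simp [glueIso_adj, glueIso_mem S T F hv, glueIso_mem S T F hw]

lemma glue_induce_compl (S : Set V) (T : SimpleGraph S) (F : SimpleGraph (Sᶜ : Set V)) :
    (glue S T F).induce Sᶜ = F := by
  ext ⟨v, hv⟩ ⟨w, hw⟩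
  simp [glueIso_adj, glueIso_notMem S T F hv, glueIso_notMem S T F hw]

lemma glue_not_adj (S : Set V) (T : SimpleGraph S) (F : SimpleGraph (Sᶜ : Set V)) {v w : V}
    (hv : v ∈ S) (hw : w ∉ S) : ¬ (glue S T F).Adj v w := by
  simp [glueIso_adj, glueIso_mem S T F hv, glueIso_notMem S T F hw]

lemma glue_eq (S : Set V) (G : SimpleGraph V) (h : ∀ v ∈ S, ∀ w, w ∉ S → ¬ G.Adj v w) :
    glue S (G.induce S) (G.induce Sᶜ) = G := by
  ext v w
  by_cases hv : v ∈ S <;> by_cases hw : w ∈ S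
  · simp [glueIso_adj, glueIso_mem S _ _ hv, glueIso_mem S _ _ hw]
  · simp [glue_not_adj S _ _ hv hw, h v hv w hw]
  · have h1 := glue_not_adj S (G.induce S) (G.induce Sᶜ) hw hv
    have h2 := h w hw v hv
    rw [adj_comm] at h1 h2
    simp [h1, h2]
  · simp [glueIso_adj, glueIso_notMem S _ _ hv, glueIso_notMem S _ _ hw]

lemma glue_acyclic (S : Set V) (T : SimpleGraph S) (F : SimpleGraph (Sᶜ : Set V)) :
    (glue S T F).IsAcyclic ↔ T.IsAcyclic ∧ F.IsAcyclic := by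
  rw [(glueIso S T F).isAcyclic_iff, sum_acyclic]

lemma iso_edges {G : SimpleGraph V} {H : SimpleGraph W} (f : G ≃g H) :
    G.edgeSet.ncard = H.edgeSet.ncard := by
  rw [← Nat.card_coe_set_eq, ← Nat.card_coe_set_eq]
  exact Nat.card_congr f.mapEdgeSet

lemma iso_comps {G : SimpleGraph V} {H : SimpleGraph W} (f : G ≃g H) :
    Nat.card G.ConnectedComponent = Nat.card H.ConnectedComponent :=
  Nat.card_congr f.connectedComponentEquiv

lemma iso_compSize {G : SimpleGraph V} {H : SimpleGraph W} (f : G ≃g H) (v : V) :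
    (G.connectedComponentMk v).supp.ncard = (H.connectedComponentMk (f v)).supp.ncard := by
  rw [← Nat.card_coe_set_eq, ← Nat.card_coe_set_eq]
  exact Nat.card_congr (ConnectedComponent.isoEquivSupp f (G.connectedComponentMk v))

lemma glue_edges [Finite V] (S : Set V) (T : SimpleGraph S) (F : SimpleGraph (Sᶜ : Set V)) :
    (glue S T F).edgeSet.ncard = T.edgeSet.ncard + F.edgeSet.ncard := by
  rw [iso_edges (glueIso S T F), sum_edges]

lemma glue_comps [Finite V] (S : Set V) (T : SimpleGraph S) (F : SimpleGraph (Sᶜ : Set V)) :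
    Nat.card (glue S T F).ConnectedComponent =
      Nat.card T.ConnectedComponent + Nat.card F.ConnectedComponent := by
  rw [iso_comps (glueIso S T F), sum_comps]

lemma glue_compSize_mem (S : Set V) (T : SimpleGraph S) (F : SimpleGraph (Sᶜ : Set V))
    {v : V} (hv : v ∈ S) : ((glue S T F).connectedComponentMk v).supp.ncard =
      (T.connectedComponentMk ⟨v, hv⟩).supp.ncard := by
  rw [iso_compSize (glueIso S T F), glueIso_mem S T F hv, sum_supp_inl,
    ncard_image_of_injective _ Sum.inl_injective]

lemma glue_compSize_notMem (S : Set V) (T : SimpleGraph S) (F : SimpleGraph (Sᶜ : Set V))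
    {v : V} (hv : v ∉ S) : ((glue S T F).connectedComponentMk v).supp.ncard =
      (F.connectedComponentMk ⟨v, hv⟩).supp.ncard := by
  rw [iso_compSize (glueIso S T F), glueIso_notMem S T F hv, sum_supp_inr,
    ncard_image_of_injective _ Sum.inr_injective]

lemma glue_reach (S : Set V) (T : SimpleGraph S) (F : SimpleGraph (Sᶜ : Set V))
    {v w : V} (hv : v ∈ S) : (glue S T F).Reachable v w ↔
      ∃ hw : w ∈ S, T.Reachable ⟨v, hv⟩ ⟨w, hw⟩ := by
  rw [← (glueIso S T F).reachable_iff, glueIso_mem S T F hv]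
  by_cases hw : w ∈ S
  · simp [glueIso_mem S T F hw, sum_reach_inl, hw]
  · simp only [glueIso_notMem S T F hw, hw, IsEmpty.exists_iff, iff_false]
    exact not_reachable_sum_inl_inr _ _

lemma glue_supp (S : Set V) (T : SimpleGraph S) (F : SimpleGraph (Sᶜ : Set V))
    {v : V} (hv : v ∈ S) (hT : T.Connected) :
    ((glue S T F).connectedComponentMk v).supp = S := by
  ext w
  rw [ConnectedComponent.mem_supp_iff, ConnectedComponent.eq, reachable_comm, glue_reach S T F hv]
  exact ⟨fun h => h.1, fun h => ⟨h, hT.preconnected _ _⟩⟩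

lemma supp_no_cross (G : SimpleGraph V) (v : V) :
    ∀ x ∈ (G.connectedComponentMk v).supp, ∀ w, w ∉ (G.connectedComponentMk v).supp →
      ¬ G.Adj x w := by
  intro x hx w hw h
  exact hw (ConnectedComponent.mem_supp_of_adj_mem_supp _ hx h)

/-- trees -/
abbrev TR (V : Type*) := {G : SimpleGraph V // G.IsTree}

/-- forests with component sizes at most `r` -/
abbrev FO (r : ℕ) (V : Type*) := {G : SimpleGraph V // G.IsAcyclic ∧
  ∀ v, (G.connectedComponentMk v).supp.ncard ≤ r}

lemma induce_supp_tree {G : SimpleGraph V} (h : G.IsAcyclic) {S : Set V} {v : V}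
    (hS : (G.connectedComponentMk v).supp = S) : (G.induce S).IsTree := by
  subst hS
  exact h.isTree_connectedComponent _

lemma compSize_of_conn [Finite V] {G : SimpleGraph V} (h : G.Connected) (v : V) :
    (G.connectedComponentMk v).supp.ncard = Nat.card V := by
  rw [← ncard_univ]
  congr 1
  ext w
  simp [ConnectedComponent.mem_supp_iff, ConnectedComponent.eq, h.preconnected w v]

/-- decomposition along the component of `v` -/
def decomp [Finite V] (r : ℕ) (v : V) (S : Set V) (hv : v ∈ S) (hr : S.ncard ≤ r) :
    {G : FO r V // (G.1.connectedComponentMk v).supp = S} ≃ TR S × FO r (Sᶜ : Set V) where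
  toFun G := ⟨⟨G.1.1.induce S, induce_supp_tree G.1.2.1 G.2⟩,
    ⟨G.1.1.induce Sᶜ, G.1.2.1.induce _, by
      rintro ⟨w, hw⟩
      have h := glue_eq S G.1.1 (by have := supp_no_cross G.1.1 v; rwa [G.2] at this)
      have h2 := G.1.2.2 w
      rw [← h, glue_compSize_notMem S _ _ hw] at h2
      exact h2⟩⟩
  invFun p := ⟨⟨glue S p.1.1 p.2.1, (glue_acyclic _ _ _).2 ⟨p.1.2.isAcyclic, p.2.2.1⟩, by
    intro w
    by_cases hw : w ∈ S
    · rw [glue_compSize_mem _ _ _ hw, compSize_of_conn p.1.2.connected, Nat.card_coe_set_eq]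
      exact hr
    · rw [glue_compSize_notMem _ _ _ hw]
      exact p.2.2.2 _⟩, glue_supp _ _ _ hv p.1.2.connected⟩
  left_inv G := by
    apply Subtype.ext
    apply Subtype.ext
    exact glue_eq S G.1.1 (by have := supp_no_cross G.1.1 v; rwa [G.2] at this)
  right_inv p := by
    apply Prod.ext
    · apply Subtype.ext; exact glue_induce _ _ _
    · apply Subtype.ext; exact glue_induce_compl _ _ _

lemma tree_edges [Finite V] {G : SimpleGraph V} (h : G.IsTree) :
    G.edgeSet.ncard + 1 = Nat.card V := by
  rw [← Nat.card_coe_set_eq]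
  exact (isTree_iff_connected_and_card.1 h).2

/-- number of edges plus number of components of a forest -/
lemma forest_card : ∀ (n : ℕ) (V : Type) [Finite V], Nat.card V = n → ∀ (G : SimpleGraph V),
    G.IsAcyclic → G.edgeSet.ncard + Nat.card G.ConnectedComponent = n := by
  intro n
  induction n using Nat.strong_induction_on with
  | _ n ih =>
    intro V _ hV G hG
    rcases isEmpty_or_nonempty V with hE | ⟨⟨v⟩⟩
    · have : G.edgeSet = ∅ := by
        ext e; refine e.ind (fun x => (hE.false x).elim)
      have h2 : IsEmpty G.ConnectedComponent := ⟨fun C => C.ind (fun x => hE.false x)⟩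
      rw [this]; simp [← hV]
    · set S := (G.connectedComponentMk v).supp with hS
      have hv : v ∈ S := by simp [hS]
      have h := glue_eq S G (supp_no_cross G v)
      have hT : (G.induce S).IsTree := induce_supp_tree hG rfl
      have hc : Nat.card S + Nat.card (Sᶜ : Set V) = n := by
        rw [Nat.card_coe_set_eq, Nat.card_coe_set_eq, ncard_add_ncard_compl, hV]
      have hpos : 0 < Nat.card S := by
        have : Nonempty S := ⟨⟨v, hv⟩⟩
        exact Nat.card_pos
      have h3 := ih (Nat.card (Sᶜ : Set V)) (by omega) (Sᶜ : Set V) rfl _ (hG.induce Sᶜ)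
      have h4 := tree_edges hT
      have h5 : Nat.card (G.induce S).ConnectedComponent = 1 := by
        rw [Nat.card_eq_one_iff_unique]
        have := hT.connected.nonempty
        exact ⟨hT.connected.preconnected.subsingleton_connectedComponent,
          this.map (G.induce S).connectedComponentMk⟩
      rw [← h, glue_edges, glue_comps]
      omega

end RC

namespace RC
open SimpleGraph

variable {A B V W : Type*}

lemma glue_reach' (S : Set V) (T : SimpleGraph S) (F : SimpleGraph (Sᶜ : Set V))
    {v w : V} (hv : v ∉ S) : (glue S T F).Reachable v w ↔
      ∃ hw : w ∉ S, F.Reachable ⟨v, hv⟩ ⟨w, hw⟩ := by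
  rw [← (glueIso S T F).reachable_iff, glueIso_notMem S T F hv]
  by_cases hw : w ∈ S
  · simp only [glueIso_mem S T F hw, hw, not_true_eq_false, IsEmpty.exists_iff, iff_false]
    intro h
    exact not_reachable_sum_inl_inr _ _ h.symm
  · simp [glueIso_notMem S T F hw, sum_reach_inr, hw]

/-- `ab` is the only edge of `T` between `S` and its complement -/
def IsCut (T : SimpleGraph V) (S : Set V) (a b : V) : Prop :=
  a ∈ S ∧ b ∉ S ∧ T.Adj a b ∧ ∀ x ∈ S, ∀ y, y ∉ S → T.Adj x y → x = a ∧ y = b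

lemma reach_delete {T : SimpleGraph V} {a b w : V} (h : T.Reachable w a) :
    (T.deleteEdges {s(a, b)}).Reachable w a ∨ (T.deleteEdges {s(a, b)}).Reachable w b := by
  obtain ⟨p⟩ := h
  induction p with
  | nil => left; exact Reachable.refl _
  | cons h p ih =>
    rename_i u v w
    by_cases he : s(u, v) = s(w, b)
    · rw [Sym2.eq_iff] at he
      rcases he with ⟨h1, -⟩ | ⟨h1, -⟩
      · left; rw [h1]
      · right; rw [h1]
    · have h1 : (T.deleteEdges {s(w, b)}).Adj u v := by simp [h, he]
      exact ih.imp (fun h => h1.reachable.trans h) (fun h => h1.reachable.trans h)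

lemma cut_mem {T : SimpleGraph V} {S : Set V} {a b : V} (h : IsCut T S a b) {x y : V}
    (hr : (T.deleteEdges {s(a, b)}).Reachable x y) : x ∈ S ↔ y ∈ S := by
  obtain ⟨p⟩ := hr
  induction p with
  | nil => rfl
  | cons h' p ih =>
    rename_i u v w
    rw [← ih]
    simp only [deleteEdges_adj, mem_singleton_iff] at h'
    obtain ⟨h1, h2⟩ := h'
    constructor
    · intro hu
      by_contra hv
      obtain ⟨rfl, rfl⟩ := h.2.2.2 u hu v hv h1
      exact h2 rfl
    · intro hv
      by_contra hu
      obtain ⟨rfl, rfl⟩ := h.2.2.2 v hv u hu h1.symm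
      exact h2 (Sym2.eq_swap)

lemma cut_supp {T : SimpleGraph V} (hT : T.Connected) {S : Set V} {a b : V} (h : IsCut T S a b) :
    ((T.deleteEdges {s(a, b)}).connectedComponentMk a).supp = S ∧
    ((T.deleteEdges {s(a, b)}).connectedComponentMk b).supp = Sᶜ := by
  constructor
  · ext w
    rw [ConnectedComponent.mem_supp_iff, ConnectedComponent.eq]
    constructor
    · intro hr; exact (cut_mem h hr).2 h.1
    · intro hw
      rcases reach_delete (b := b) (hT.preconnected w a) with h1 | h1
      · exact h1
      · exact absurd ((cut_mem h h1).1 hw) h.2.1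
  · ext w
    rw [ConnectedComponent.mem_supp_iff, ConnectedComponent.eq]
    constructor
    · intro hr hw; exact h.2.1 ((cut_mem h hr).1 hw)
    · intro hw
      rcases reach_delete (b := b) (hT.preconnected w a) with h1 | h1
      · exact absurd ((cut_mem h h1).2 h.1) hw
      · exact h1

lemma exists_cut {T : SimpleGraph V} (hT : T.IsTree) {a b : V} (hab : T.Adj a b) :
    ∃! S : Set V, IsCut T S a b := by
  refine ⟨((T.deleteEdges {s(a, b)}).connectedComponentMk a).supp, ?_, ?_⟩
  · have hb := isBridge_iff.1 (isAcyclic_iff_forall_adj_isBridge.1 hT.isAcyclic hab)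
    have hb' : b ∉ ((T.deleteEdges {s(a, b)}).connectedComponentMk a).supp := by
      rw [ConnectedComponent.mem_supp_iff, ConnectedComponent.eq]
      exact fun h => hb h.symm
    refine ⟨by simp, hb', hab, ?_⟩
    intro x hx y hy hxy
    by_cases he : s(x, y) = s(a, b)
    · rw [Sym2.eq_iff] at he
      rcases he with h | ⟨rfl, rfl⟩
      · exact h
      · exact absurd hx hb'
    · exact absurd (ConnectedComponent.mem_supp_of_adj_mem_supp _ hx (by simp [hxy, he])) hy
  · intro S hS
    exact (cut_supp hT.connected hS).1.symm

lemma cut_induce {T : SimpleGraph V} {R : Set V} {a b : V} (h : a ∉ R ∨ b ∉ R) :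
    (T.deleteEdges {s(a, b)}).induce R = T.induce R := by
  ext ⟨x, hx⟩ ⟨y, hy⟩
  simp only [comap_adj, Function.Embedding.subtype_apply, deleteEdges_adj, mem_singleton_iff,
    and_iff_left_iff_imp]
  intro _ he
  rw [Sym2.eq_iff] at he
  rcases he with ⟨rfl, rfl⟩ | ⟨rfl, rfl⟩ <;> tauto

def cutEquiv (S : Set V) (a b : V) (ha : a ∈ S) (hb : b ∉ S) :
    {T : TR V // IsCut T.1 S a b} ≃ TR S × TR (Sᶜ : Set V) where
  toFun T := ⟨⟨T.1.1.induce S, by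
      have h := cut_supp T.1.2.connected T.2
      rw [← cut_induce (Or.inr hb : a ∉ S ∨ b ∉ S)]
      exact induce_supp_tree (T.1.2.isAcyclic.anti (deleteEdges_le _)) h.1⟩,
    ⟨T.1.1.induce Sᶜ, by
      have h := cut_supp T.1.2.connected T.2
      rw [← cut_induce (Or.inl (by simpa using ha) : a ∉ Sᶜ ∨ b ∉ Sᶜ)]
      exact induce_supp_tree (T.1.2.isAcyclic.anti (deleteEdges_le _)) h.2⟩⟩
  invFun p := ⟨⟨glue S p.1.1 p.2.1 ⊔ edge a b, by
      have hab : a ≠ b := fun h => hb (h ▸ ha)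
      have hadj : (glue S p.1.1 p.2.1 ⊔ edge a b).Adj b a := by
        simp [edge_adj, hab.symm]
      have : Nonempty V := ⟨a⟩
      refine ⟨Connected.mk ?_, ?_⟩
      · have : ∀ x, (glue S p.1.1 p.2.1 ⊔ edge a b).Reachable x a := by
          intro x
          by_cases hx : x ∈ S
          · exact ((glue_reach S p.1.1 p.2.1 hx).2
              ⟨ha, p.1.2.connected.preconnected _ _⟩).mono le_sup_left
          · exact (((glue_reach' S p.1.1 p.2.1 hx).2
              ⟨hb, p.2.2.connected.preconnected _ _⟩).mono le_sup_left).trans hadj.reachable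
        exact fun x y => (this x).trans (this y).symm
      · apply IsAcyclic.sup_edge_of_not_reachable
        · rw [glue_reach S p.1.1 p.2.1 ha]
          rintro ⟨h, -⟩; exact hb h
        · exact (glue_acyclic _ _ _).2 ⟨p.1.2.isAcyclic, p.2.2.isAcyclic⟩⟩, by
      have hab : a ≠ b := fun h => hb (h ▸ ha)
      refine ⟨ha, hb, by simp [edge_adj, hab], ?_⟩
      intro x hx y hy hxy
      rcases hxy with h | h
      · exact absurd h (glue_not_adj S _ _ hx hy)
      · rw [edge_adj] at h
        rcases h.1 with h | ⟨rfl, rfl⟩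
        · exact h
        · exact absurd hx hb⟩
  left_inv T := by
    apply Subtype.ext
    apply Subtype.ext
    have h1 := cut_induce (T := T.1.1) (Or.inr hb : a ∉ S ∨ b ∉ S)
    have h2 := cut_induce (T := T.1.1) (Or.inl (by simpa using ha) : a ∉ Sᶜ ∨ b ∉ Sᶜ)
    have h3 := glue_eq S (T.1.1.deleteEdges {s(a, b)}) (by
      intro x hx y hy h
      exact hy ((cut_mem T.2 h.reachable).1 hx))
    rw [h1, h2] at h3
    show glue S (T.1.1.induce S) (T.1.1.induce Sᶜ) ⊔ edge a b = T.1.1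
    rw [h3]
    have hab : T.1.1.Adj a b := T.2.2.2.1
    ext x y
    simp only [sup_adj, deleteEdges_adj, mem_singleton_iff, edge_adj, Sym2.eq_iff]
    constructor
    · rintro (h | ⟨⟨rfl, rfl⟩ | ⟨rfl, rfl⟩, -⟩)
      · exact h.1
      · exact hab
      · exact hab.symm
    · intro h
      have := h.ne
      tauto
  right_inv p := by
    have hs : ∀ R : Set V, (a ∉ R ∨ b ∉ R) → (glue S p.1.1 p.2.1 ⊔ edge a b).induce R =
        (glue S p.1.1 p.2.1).induce R := by
      intro R hR
      ext ⟨x, hx⟩ ⟨y, hy⟩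
      simp only [comap_adj, Function.Embedding.subtype_apply, sup_adj, edge_adj,
        or_iff_left_iff_imp]
      rintro ⟨⟨rfl, rfl⟩ | ⟨rfl, rfl⟩, -⟩ <;> tauto
    apply Prod.ext
    · apply Subtype.ext
      exact (hs S (Or.inr hb)).trans (glue_induce _ _ _)
    · apply Subtype.ext
      exact (hs Sᶜ (Or.inl (by simpa using ha))).trans (glue_induce_compl _ _ _)

end RC

namespace RC
open SimpleGraph

variable {A B V W : Type*}

/-- number of labelled trees -/
def tc (n : ℕ) : ℕ := Nat.card (TR (Fin n))

def trCongr (e : V ≃ W) : TR V ≃ TR W :=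
  Equiv.subtypeEquiv e.simpleGraph (fun G => (Iso.comap e.symm G).isTree_iff.symm)

lemma card_TR [Finite V] : Nat.card (TR V) = tc (Nat.card V) :=
  Nat.card_congr (trCongr (Finite.equivFin V))

def foCongr (r : ℕ) (e : V ≃ W) : FO r V ≃ FO r W :=
  Equiv.subtypeEquiv e.simpleGraph (fun G => by
    have f : e.simpleGraph G ≃g G := Iso.comap e.symm G
    rw [f.isAcyclic_iff]
    refine and_congr_right (fun _ => ?_)
    constructor
    · intro h w
      rw [iso_compSize f]; exact h _
    · intro h v
      have := h (f.symm v)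
      rw [iso_compSize f] at this
      simpa using this)

/-- weighted forest sum -/
def FS (r : ℕ) (V : Type*) (y : ℝ) : ℝ := ∑ᶠ G : FO r V, y ^ G.1.edgeSet.ncard

def PP (r n : ℕ) (y : ℝ) : ℝ := FS r (Fin n) y

lemma FS_eq [Finite V] (r : ℕ) (y : ℝ) : FS r V y = PP r (Nat.card V) y := by
  have e := Finite.equivFin V
  refine finsum_eq_of_bijective (foCongr r e) (foCongr r e).bijective ?_
  intro G
  congr 1
  exact (iso_edges (Iso.comap e.symm G.1)).symm

open Classical in
lemma FS_fiber [Fintype V] (r : ℕ) (y : ℝ) (v : V) (S : Finset V) :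
    ∑ᶠ G : {G : FO r V // (G.1.connectedComponentMk v).supp = (S : Set V)},
      y ^ G.1.1.edgeSet.ncard = if v ∈ S ∧ S.card ≤ r then
        (tc S.card : ℝ) * y ^ (S.card - 1) * PP r (Fintype.card V - S.card) y else 0 := by
  split_ifs with h
  · have hS : (S : Set V).ncard ≤ r := by rw [ncard_coe_finset]; exact h.2
    rw [finsum_eq_of_bijective (g := fun p : TR (S : Set V) × FO r ((S : Set V)ᶜ : Set V) =>
      y ^ (S.card - 1) * y ^ p.2.1.edgeSet.ncard) (decomp r v S h.1 hS)
      (decomp r v S h.1 hS).bijective]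
    · have i1 : Fintype (TR (S : Set V)) := Fintype.ofFinite _
      have i2 : Fintype (FO r ((S : Set V)ᶜ : Set V)) := Fintype.ofFinite _
      rw [finsum_eq_sum_of_fintype, Fintype.sum_prod_type]
      simp only [Finset.sum_const, ← Finset.mul_sum]
      have h1 := FS_eq (V := ((S : Set V)ᶜ : Set V)) r y
      rw [FS, finsum_eq_sum_of_fintype] at h1
      rw [h1, Finset.card_univ, ← Nat.card_eq_fintype_card, card_TR, Nat.card_coe_set_eq,
        Nat.card_coe_set_eq, ncard_compl, ncard_coe_finset, Nat.card_eq_fintype_card]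
      simp; ring
    · intro G
      have h1 := (decomp r v S h.1 hS).left_inv G
      have h2 := glue_edges (S : Set V) ((decomp r v S h.1 hS) G).1.1 ((decomp r v S h.1 hS) G).2.1
      have h3 : glue (S : Set V) ((decomp r v S h.1 hS) G).1.1 ((decomp r v S h.1 hS) G).2.1
        = G.1.1 := by
        conv_rhs => rw [← h1]
        rfl
      rw [h3] at h2
      have h4 := tree_edges ((decomp r v S h.1 hS) G).1.2
      rw [Nat.card_coe_set_eq, ncard_coe_finset] at h4
      rw [h2, ← pow_add]
      congr 1
      omega
  · have : IsEmpty {G : FO r V // (G.1.connectedComponentMk v).supp = (S : Set V)} := by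
      constructor
      rintro ⟨G, hG⟩
      apply h
      have h1 := G.2.2 v
      rw [hG, ncard_coe_finset] at h1
      refine ⟨?_, h1⟩
      rw [← Finset.mem_coe, ← hG]
      simp
    rw [finsum_of_isEmpty]

theorem PP_rec (r n : ℕ) (y : ℝ) : PP r (n + 1) y =
    ∑ i ∈ Finset.range (n + 1), if i < r then
      (n.choose i : ℝ) * tc (i + 1) * y ^ i * PP r (n - i) y else 0 := by
  classical
  have i1 : Fintype (FO r (Fin (n + 1))) := Fintype.ofFinite _
  have h0 : PP r (n + 1) y = ∑ S : Finset (Fin (n + 1)),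
      ∑ᶠ G : {G : FO r (Fin (n + 1)) // (G.1.connectedComponentMk 0).supp = (S : Set (Fin (n + 1)))},
      y ^ G.1.1.edgeSet.ncard := by
    rw [PP, FS, finsum_eq_sum_of_fintype]
    rw [← Finset.sum_fiberwise Finset.univ (fun G : FO r (Fin (n + 1)) =>
      (G.1.connectedComponentMk 0).supp.toFinset)]
    refine Finset.sum_congr rfl (fun S _ => ?_)
    have i2 : Fintype {G : FO r (Fin (n + 1)) //
      (G.1.connectedComponentMk 0).supp = (S : Set (Fin (n + 1)))} := Fintype.ofFinite _
    rw [finsum_eq_sum_of_fintype]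
    rw [Finset.sum_subtype (p := fun G : FO r (Fin (n + 1)) =>
      (G.1.connectedComponentMk 0).supp = (S : Set (Fin (n + 1))))]
    intro G
    simp only [Finset.mem_filter, Finset.mem_univ, true_and]
    rw [← Finset.coe_inj, coe_toFinset]
  rw [h0]
  simp only [FS_fiber]
  have hu : (Finset.univ : Finset (Finset (Fin (n + 1)))) =
      (insert 0 (Finset.univ.erase (0 : Fin (n + 1)))).powerset := by
    rw [Finset.insert_erase (Finset.mem_univ _)]; simp
  rw [hu, Finset.sum_powerset_insert (Finset.notMem_erase _ _)]
  refine (congrArg₂ (· + ·) (?_ : _ = (0 : ℝ)) rfl).trans ((zero_add _).trans ?_)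
  · refine Finset.sum_eq_zero (fun t ht => ?_)
    rw [if_neg]
    rintro ⟨h, -⟩
    exact Finset.notMem_erase _ _ (Finset.mem_powerset.1 ht h)
  have h2 := Finset.sum_powerset_apply_card (fun k => if k < r then
      (tc (k + 1) : ℝ) * y ^ k * PP r (n - k) y else 0) (x := Finset.univ.erase (0 : Fin (n + 1)))
  have hc : (Finset.univ.erase (0 : Fin (n + 1))).card = n := by simp
  rw [hc] at h2
  rw [Finset.sum_congr rfl (g := fun t : Finset (Fin (n + 1)) => if t.card < r then
      (tc (t.card + 1) : ℝ) * y ^ t.card * PP r (n - t.card) y else 0), h2]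
  · refine Finset.sum_congr rfl (fun i _ => ?_)
    split_ifs <;> simp; ring
  · intro t ht
    have h0t : (0 : Fin (n + 1)) ∉ t := fun h =>
      Finset.notMem_erase _ _ (Finset.mem_powerset.1 ht h)
    rw [Finset.card_insert_of_notMem h0t]
    simp [Nat.succ_le_iff]

lemma PP_zero (r : ℕ) (y : ℝ) : PP r 0 y = 1 := by
  have : Unique (FO r (Fin 0)) :=
    { default := ⟨⊥, isAcyclic_bot, fun v => v.elim0⟩
      uniq := fun G => Subtype.ext (Subsingleton.elim _ _) }
  rw [PP, FS, finsum_unique]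
  have : (default : FO r (Fin 0)).1.edgeSet = ∅ := by
    ext e; refine e.ind (fun x => x.elim0)
  rw [this]; simp

lemma tc_one : tc 1 = 1 := by
  rw [tc, Nat.card_eq_one_iff_unique]
  exact ⟨⟨fun a b => Subtype.ext (Subsingleton.elim _ _)⟩, ⟨⟨⊥, IsTree.of_subsingleton⟩⟩⟩

open Classical in
theorem tc_rec (n : ℕ) : 2 * (n - 1) * tc n =
    ∑ k ∈ Finset.range (n + 1), n.choose k * (k * (n - k) * (tc k * tc (n - k))) := by
  have i1 : Fintype (TR (Fin n)) := Fintype.ofFinite _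
  have e1 : ∑ T : TR (Fin n), ∑ a, ∑ b, (if T.1.Adj a b then 1 else 0) = 2 * (n - 1) * tc n := by
    rw [Finset.sum_congr rfl (g := fun _ => 2 * (n - 1))]
    · simp [tc, Nat.card_eq_fintype_card]; ring
    · intro T _
      have h1 := T.1.sum_degrees_eq_twice_card_edges
      have h2 := T.2.card_edgeFinset
      simp only [Fintype.card_fin] at h2
      rw [show n - 1 = T.1.edgeFinset.card by omega, ← h1]
      refine Finset.sum_congr rfl (fun a _ => ?_)
      rw [← card_neighborFinset_eq_degree, neighborFinset_eq_filter]
      simp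
  have e2 : ∀ (T : TR (Fin n)) (a b : Fin n), (if T.1.Adj a b then 1 else 0) =
      ∑ S : Finset (Fin n), if IsCut T.1 (S : Set (Fin n)) a b then 1 else 0 := by
    intro T a b
    split_ifs with h
    · obtain ⟨S, hS, hu⟩ := exists_cut T.2 h
      rw [Finset.sum_eq_single S.toFinset]
      · simp [hS]
      · intro S' _ hne
        rw [if_neg]
        intro h'
        apply hne
        rw [← Finset.coe_inj, hu _ h']; simp
      · simp
    · symm
      refine Finset.sum_eq_zero (fun S _ => if_neg (fun h' => h h'.2.2.1))
  have e3 : ∀ (S : Finset (Fin n)) (a b : Fin n),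
      ∑ T : TR (Fin n), (if IsCut T.1 (S : Set (Fin n)) a b then 1 else 0) =
      (if a ∈ S then 1 else 0) * (if b ∈ Sᶜ then 1 else 0) *
        (tc S.card * tc (n - S.card)) := by
    intro S a b
    by_cases ha : a ∈ S
    · by_cases hb : b ∈ S
      · simp only [ha, hb]
        refine (Finset.sum_eq_zero (fun T _ => if_neg (fun h' => h'.2.1 hb))).trans ?_
        simp [hb]
      · have := Nat.card_congr (cutEquiv (S : Set (Fin n)) a b ha hb)
        rw [Nat.card_prod, card_TR, card_TR, Nat.card_coe_set_eq,
          Nat.card_coe_set_eq, ncard_compl, ncard_coe_finset, Nat.card_eq_fintype_card,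
          Nat.card_eq_fintype_card, Fintype.card_fin, Fintype.card_subtype] at this
        rw [← this]
        simp [ha, hb]
    · simp only [ha]
      refine (Finset.sum_eq_zero (fun T _ => if_neg (fun h' => ha h'.1))).trans ?_
      simp
  rw [← e1]
  simp only [e2]
  have e4 : ∑ T : TR (Fin n), ∑ a, ∑ b, ∑ S : Finset (Fin n),
      (if IsCut T.1 (S : Set (Fin n)) a b then 1 else 0) =
      ∑ S : Finset (Fin n), ∑ a, ∑ b, ∑ T : TR (Fin n),
      (if IsCut T.1 (S : Set (Fin n)) a b then 1 else 0) := by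
    rw [Finset.sum_comm]
    simp_rw [Finset.sum_comm (s := (Finset.univ : Finset (TR (Fin n))))]
    simp_rw [Finset.sum_comm (t := (Finset.univ : Finset (Finset (Fin n))))]
  rw [e4]
  simp only [e3]
  have h2 := Finset.sum_powerset_apply_card (fun k => k * (n - k) * (tc k * tc (n - k)))
    (x := (Finset.univ : Finset (Fin n)))
  rw [Finset.card_univ, Fintype.card_fin] at h2
  simp only [smul_eq_mul] at h2
  rw [← h2, Finset.powerset_univ]
  refine Finset.sum_congr rfl (fun S _ => ?_)
  simp only [← Finset.sum_mul, ← Finset.mul_sum]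
  congr 1
  have : (∑ b : Fin n, if b ∈ Sᶜ then 1 else 0) = n - S.card := by
    rw [Finset.sum_boole]
    simp [Finset.filter_not, Finset.card_sdiff]
  rw [this]
  simp

end RC

namespace RC

/-- normalised tree numbers -/
def mm (k : ℕ) : ℝ := (tc (k + 1) : ℝ) / (k.factorial : ℝ)

lemma mm_nonneg (k : ℕ) : 0 ≤ mm k := by unfold mm; positivity

lemma mm_zero : mm 0 = 1 := by simp [mm, tc_one]

lemma tc_eq (k : ℕ) : (tc (k + 1) : ℝ) = mm k * k.factorial := by
  unfold mm; field_simp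

lemma mm_rec0 (k : ℕ) : 2 * ((k : ℝ) + 1) * mm (k + 1) =
    (k + 2) * ∑ i ∈ Finset.range (k + 1), mm i * mm (k - i) := by
  have h := tc_rec (k + 2)
  rw [Finset.sum_range_succ, Finset.sum_range_succ'] at h
  simp only [Nat.sub_self, mul_zero, zero_mul, add_zero] at h
  have h' : (2 * ((k : ℝ) + 1) * tc (k + 2)) = ∑ i ∈ Finset.range (k + 1),
      (((k + 2).factorial : ℝ)) * (mm i * mm (k - i)) := by
    have h2 := congrArg (fun n : ℕ => (n : ℝ)) h
    simp only [Nat.cast_mul, Nat.cast_sum] at h2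
    have h3 : ((k + 2 - 1 : ℕ) : ℝ) = (k : ℝ) + 1 := by
      rw [show k + 2 - 1 = k + 1 by omega]; push_cast; ring
    rw [h3] at h2
    push_cast at h2 ⊢
    rw [h2]
    refine Finset.sum_congr rfl (fun i hi => ?_)
    have hi' : i ≤ k := by simpa [Nat.lt_succ_iff] using hi
    obtain ⟨j, rfl⟩ := Nat.exists_eq_add_of_le hi'
    rw [show i + j + 1 - i = j + 1 by omega, show i + j - i = j by omega, tc_eq, tc_eq]
    have h4 := Nat.add_choose_mul_factorial_mul_factorial (i + 1) (j + 1)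
    have h5 : ((i + 1 + (j + 1)).choose (i + 1) : ℝ) * (i + 1).factorial * (j + 1).factorial
      = (i + j + 2).factorial := by
      rw [show i + j + 2 = i + 1 + (j + 1) by ring]; rw [Nat.choose_symm_add]; exact_mod_cast h4
    rw [show i + j + 2 = i + 1 + (j + 1) by ring] at *
    rw [← h5, Nat.factorial_succ i, Nat.factorial_succ j]
    push_cast; ring
  rw [tc_eq, ← Finset.mul_sum] at h'
  have h6 : ((k + 2).factorial : ℝ) = (k + 2) * (k + 1).factorial := by
    rw [Nat.factorial_succ]; push_cast; ring
  rw [h6] at h'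
  have h7 : ((k + 1).factorial : ℝ) ≠ 0 := by positivity
  apply mul_right_cancel₀ h7
  linarith

lemma mm_rec (k : ℕ) : ((k : ℝ) + 1) * mm (k + 1) =
    ∑ i ∈ Finset.range (k + 1), mm i * (((k - i : ℕ) + 1 : ℝ) * mm (k - i)) := by
  have h := mm_rec0 k
  have h1 : ∑ i ∈ Finset.range (k + 1), mm i * (((k - i : ℕ) + 1 : ℝ) * mm (k - i)) =
      ∑ i ∈ Finset.range (k + 1), mm (k - i) * (((i : ℕ) + 1 : ℝ) * mm i) := by
    rw [← Finset.sum_range_reflect]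
    refine Finset.sum_congr rfl (fun i hi => ?_)
    have hi' : i ≤ k := by simpa [Nat.lt_succ_iff] using hi
    rw [show k + 1 - 1 - i = k - i by omega, show k - (k - i) = i by omega]
  have h2 : 2 * ∑ i ∈ Finset.range (k + 1), mm i * (((k - i : ℕ) + 1 : ℝ) * mm (k - i)) =
     (k + 2) * ∑ i ∈ Finset.range (k + 1), mm i * mm (k - i) := by
    rw [two_mul]
    conv_lhs => arg 2; rw [h1]
    rw [← Finset.sum_add_distrib, Finset.mul_sum]
    refine Finset.sum_congr rfl (fun i hi => ?_)
    have hi' : i ≤ k := by simpa [Nat.lt_succ_iff] using hi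
    rw [Nat.cast_sub hi']
    ring
  linarith

/-- truncated generating function -/
def MM (N : ℕ) (w : ℝ) : ℝ := ∑ k ∈ Finset.range N, mm k * w ^ k

lemma diag_le (f g : ℕ → ℝ) (hf : ∀ i, 0 ≤ f i) (hg : ∀ i, 0 ≤ g i) (K N : ℕ) (h : K ≤ N) :
    ∑ k ∈ Finset.range K, ∑ i ∈ Finset.range (k + 1), f i * g (k - i) ≤
      (∑ i ∈ Finset.range N, f i) * ∑ i ∈ Finset.range N, g i := by
  rw [Finset.sum_range_diag_flip K (fun i j => f i * g j)]
  rw [Finset.sum_mul]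
  refine (Finset.sum_le_sum_of_subset_of_nonneg (Finset.range_subset_range.2 h) ?_).trans'
    (Finset.sum_le_sum (fun i _ => ?_))
  · intro i _ _
    exact mul_nonneg (hf i) (Finset.sum_nonneg (fun j _ => hg j))
  · rw [← Finset.mul_sum]
    refine mul_le_mul_of_nonneg_left ?_ (hf i)
    exact Finset.sum_le_sum_of_subset_of_nonneg (Finset.range_subset_range.2 (by omega))
      (fun j _ _ => hg j)

def MM' (N : ℕ) (w : ℝ) : ℝ := ∑ k ∈ Finset.range N, mm k * (k * w ^ (k - 1))

lemma MM_deriv (N : ℕ) (w : ℝ) : HasDerivAt (MM N) (MM' N w) w := by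
  unfold MM MM'
  exact HasDerivAt.fun_sum (fun k _ => (hasDerivAt_pow k w).const_mul _)

lemma MM_nonneg (N : ℕ) {w : ℝ} (hw : 0 ≤ w) : 0 ≤ MM N w :=
  Finset.sum_nonneg (fun k _ => mul_nonneg (mm_nonneg k) (by positivity))

lemma MM_ode (N : ℕ) {w : ℝ} (hw : 0 ≤ w) : MM' N w ≤ MM N w * (MM N w + w * MM' N w) := by
  have h1 : MM N w + w * MM' N w = ∑ k ∈ Finset.range N, ((k : ℝ) + 1) * mm k * w ^ k := by
    unfold MM MM'
    rw [Finset.mul_sum, ← Finset.sum_add_distrib]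
    refine Finset.sum_congr rfl (fun k _ => ?_)
    rcases k with _ | k
    · simp
    · simp [pow_succ]; ring
  have h2 : MM' N w ≤ ∑ k ∈ Finset.range (N - 1), ∑ i ∈ Finset.range (k + 1),
      (mm i * w ^ i) * (((k - i : ℕ) + 1 : ℝ) * mm (k - i) * w ^ (k - i)) := by
    unfold MM'
    rcases N with _ | N
    · simp
    · rw [Finset.sum_range_succ']
      simp only [Nat.cast_zero, zero_mul, mul_zero, add_zero, Nat.add_sub_cancel]
      refine Finset.sum_le_sum (fun k _ => ?_)
      have := mm_rec k
      have e : mm (k + 1) * (((k + 1 : ℕ) : ℝ) * w ^ k) = (((k : ℝ) + 1) * mm (k + 1)) * w ^ k := by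
        push_cast; ring
      rw [e, this, Finset.sum_mul]
      refine Finset.sum_le_sum (fun i hi => ?_)
      have hi' : i ≤ k := by simpa [Nat.lt_succ_iff] using hi
      have : w ^ k = w ^ i * w ^ (k - i) := by rw [← pow_add]; congr 1; omega
      rw [this]
      apply le_of_eq; ring
  rw [h1]
  refine h2.trans ?_
  exact diag_le (fun i => mm i * w ^ i) (fun i => ((i : ℝ) + 1) * mm i * w ^ i)
    (fun i => mul_nonneg (mm_nonneg i) (by positivity))
    (fun i => mul_nonneg (mul_nonneg (by positivity) (mm_nonneg i)) (by positivity)) _ _ (by omega)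

lemma MM_zero (N : ℕ) : MM N 0 ≤ 1 := by
  unfold MM
  rcases N with _ | N
  · simp
  · rw [Finset.sum_range_succ']; simp [mm_zero]

lemma MM_exp_le (N : ℕ) {w : ℝ} (hw : 0 ≤ w) : MM N w * Real.exp (-(w * MM N w)) ≤ 1 := by
  have hd : ∀ x, HasDerivAt (fun w => MM N w * Real.exp (-(w * MM N w)))
      (MM' N x * Real.exp (-(x * MM N x)) + MM N x * (Real.exp (-(x * MM N x)) *
        (-(1 * MM N x + x * MM' N x)))) x := fun x =>
    (MM_deriv N x).mul ((((hasDerivAt_id x).mul (MM_deriv N x)).neg).exp)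
  have ha : AntitoneOn (fun w => MM N w * Real.exp (-(w * MM N w))) (Ici 0) := by
    apply antitoneOn_of_deriv_nonpos (convex_Ici 0)
    · exact fun x _ => (hd x).continuousAt.continuousWithinAt
    · exact fun x _ => (hd x).differentiableAt.differentiableWithinAt
    · intro x hx
      rw [interior_Ici] at hx
      rw [(hd x).deriv]
      have := MM_ode N (le_of_lt hx)
      have h2 := (Real.exp_pos (-(x * MM N x))).le
      nlinarith
  have := ha (self_mem_Ici) hw hw
  simp only [zero_mul, neg_zero, Real.exp_zero, mul_one] at this
  exact this.trans (MM_zero N)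

lemma MM_mono (N : ℕ) {x w : ℝ} (hx : 0 ≤ x) (hw : x ≤ w) : MM N x ≤ MM N w := by
  unfold MM
  exact Finset.sum_le_sum (fun k _ => mul_le_mul_of_nonneg_left (pow_le_pow_left₀ hx hw k)
    (mm_nonneg k))

lemma MM_cont (N : ℕ) : Continuous (MM N) := by
  unfold MM; fun_prop

/-- `R_N(σ e^{-σ}) ≤ σ` -/
lemma Q_le (N : ℕ) {s : ℝ} (hs : 0 ≤ s) :
    (s * Real.exp (-s)) * MM N (s * Real.exp (-s)) ≤ s := by
  set w := s * Real.exp (-s) with hw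
  have hw0 : 0 ≤ w := by positivity
  by_contra! hlt
  have hc : ContinuousOn (fun x => x * MM N x) (Icc 0 w) :=
    (continuous_id.mul (MM_cont N)).continuousOn
  have := intermediate_value_Icc hw0 hc
  obtain ⟨x, ⟨hx0, hxw⟩, hx⟩ := this (show s ∈ Icc _ _ from ⟨by simpa using hs, hlt.le⟩)
  simp only at hx
  have h1 := MM_exp_le N hx0
  rw [hx] at h1
  have h2 : s * Real.exp (-s) ≤ x := by
    rw [← hx] at h1 ⊢
    nlinarith
  have : x = w := le_antisymm hxw h2
  rw [← this, hx] at hlt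
  exact lt_irrefl _ hlt

/-- Chernoff-type upper bound -/
lemma chernoff (y : ℝ) (hy : 0 < y) (c : ℕ → ℝ) (hc : ∀ n, 0 ≤ c n) (h0 : c 0 = 1)
    (hrec : ∀ n : ℕ, ((n : ℝ) + 1) * y * c (n + 1) ≤
      ∑ i ∈ Finset.range (n + 1), mm i * c (n - i))
    {s : ℝ} (hs : 0 ≤ s) (hs1 : s ≤ 1) (n : ℕ) :
    c n * (s * Real.exp (-s)) ^ n ≤ Real.exp ((s - s ^ 2 / 2) / y) := by
  set N := n + 1 with hN
  set A : ℝ → ℝ := fun w => ∑ k ∈ Finset.range N, c k * w ^ k with hA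
  set A' : ℝ → ℝ := fun w => ∑ k ∈ Finset.range N, c k * (k * w ^ (k - 1)) with hA'
  have hAd : ∀ w, HasDerivAt A (A' w) w := fun w =>
    HasDerivAt.fun_sum (fun k _ => (hasDerivAt_pow k w).const_mul _)
  have hA0 : ∀ w, 0 ≤ w → 0 ≤ A w := fun w hw =>
    Finset.sum_nonneg (fun k _ => mul_nonneg (hc k) (by positivity))
  have hode : ∀ w, 0 ≤ w → y * A' w ≤ MM N w * A w := by
    intro w hw
    have h2 : y * A' w ≤ ∑ k ∈ Finset.range n, ∑ i ∈ Finset.range (k + 1),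
      (mm i * w ^ i) * (c (k - i) * w ^ (k - i)) := by
      simp only [hA', hN]
      rw [Finset.sum_range_succ']
      simp only [Nat.cast_zero, zero_mul, mul_zero, add_zero, Nat.add_sub_cancel]
      rw [Finset.mul_sum]
      refine Finset.sum_le_sum (fun k _ => ?_)
      have e : y * (c (k + 1) * (((k + 1 : ℕ) : ℝ) * w ^ k)) =
        (((k : ℝ) + 1) * y * c (k + 1)) * w ^ k := by
        push_cast; ring
      rw [e]
      refine (mul_le_mul_of_nonneg_right (hrec k) (by positivity)).trans ?_
      rw [Finset.sum_mul]
      refine Finset.sum_le_sum (fun i hi => ?_)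
      have hi' : i ≤ k := by simpa [Nat.lt_succ_iff] using hi
      have : w ^ k = w ^ i * w ^ (k - i) := by rw [← pow_add]; congr 1; omega
      rw [this]
      apply le_of_eq; ring
    refine h2.trans ?_
    exact diag_le (fun i => mm i * w ^ i) (fun i => c i * w ^ i)
      (fun i => mul_nonneg (mm_nonneg i) (by positivity))
      (fun i => mul_nonneg (hc i) (by positivity)) _ _ (by omega)
  have hw : ∀ s, HasDerivAt (fun s : ℝ => s * Real.exp (-s))
      (1 * Real.exp (-s) + s * (Real.exp (-s) * (-1))) s := fun s =>
    (hasDerivAt_id s).mul ((hasDerivAt_id s).neg.exp)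
  have hE : ∀ s, HasDerivAt (fun s : ℝ => Real.exp (-((s - s ^ 2 / 2) / y)))
      (Real.exp (-((s - s ^ 2 / 2) / y)) * (-((1 - (2 : ℕ) * s ^ (2 - 1) / 2) / y))) s := fun s =>
    ((((hasDerivAt_id s).sub ((hasDerivAt_pow 2 s).div_const 2)).div_const y).neg).exp
  have hd : ∀ s, HasDerivAt (fun s => A (s * Real.exp (-s)) * Real.exp (-((s - s ^ 2 / 2) / y)))
      ((A' (s * Real.exp (-s)) * (1 * Real.exp (-s) + s * (Real.exp (-s) * (-1)))) *
        Real.exp (-((s - s ^ 2 / 2) / y)) + A (s * Real.exp (-s)) *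
        (Real.exp (-((s - s ^ 2 / 2) / y)) * (-((1 - (2 : ℕ) * s ^ (2 - 1) / 2) / y)))) s := fun s =>
    ((hAd _).comp s (hw s)).mul (hE s)
  have ha : AntitoneOn (fun s => A (s * Real.exp (-s)) * Real.exp (-((s - s ^ 2 / 2) / y)))
      (Icc 0 1) := by
    apply antitoneOn_of_deriv_nonpos (convex_Icc 0 1)
    · exact fun x _ => (hd x).continuousAt.continuousWithinAt
    · exact fun x _ => (hd x).differentiableAt.differentiableWithinAt
    · intro x hx
      rw [interior_Icc] at hx
      obtain ⟨hx0, hx1⟩ := hx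
      rw [(hd x).deriv]
      have hw0 : 0 ≤ x * Real.exp (-x) := by positivity
      have h1 := hode _ hw0
      have h2 := hA0 _ hw0
      have h3 : Real.exp (-x) * MM N (x * Real.exp (-x)) ≤ 1 := by
        have := Q_le N hx0.le
        rw [mul_assoc] at this
        have h5 : x * (Real.exp (-x) * MM N (x * Real.exp (-x))) ≤ x * 1 := by linarith
        exact le_of_mul_le_mul_left h5 hx0
      set W := x * Real.exp (-x)
      have h4 : A' W * (1 * Real.exp (-x) + x * (Real.exp (-x) * (-1))) ≤ A W * ((1 - x) / y) := by
        have e1 : A' W * (1 * Real.exp (-x) + x * (Real.exp (-x) * (-1))) =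
          (y * A' W) * Real.exp (-x) * ((1 - x) / y) := by field_simp; ring
        rw [e1]
        refine mul_le_mul_of_nonneg_right ?_ (div_nonneg (by linarith) hy.le)
        calc (y * A' W) * Real.exp (-x) ≤ (MM N W * A W) * Real.exp (-x) :=
              mul_le_mul_of_nonneg_right h1 (Real.exp_pos _).le
          _ = A W * (Real.exp (-x) * MM N W) := by ring
          _ ≤ A W * 1 := mul_le_mul_of_nonneg_left h3 h2
          _ = A W := mul_one _
      have h6 := (Real.exp_pos (-((x - x ^ 2 / 2) / y))).le
      have e2 : ((1 - ((2 : ℕ) : ℝ) * x ^ (2 - 1) / 2) / y) = (1 - x) / y := by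
        congr 1; norm_num
      rw [e2]
      nlinarith [mul_le_mul_of_nonneg_right h4 h6]
  have h7 := ha (left_mem_Icc.2 zero_le_one) ⟨hs, hs1⟩ hs
  have hA00 : A 0 = 1 := by
    simp only [hA, hN]
    rw [Finset.sum_range_succ']; simp [h0]
  simp only [zero_mul, ne_eq, OfNat.ofNat_ne_zero, not_false_eq_true, zero_pow, zero_div, sub_zero,
    neg_zero, Real.exp_zero, mul_one, hA00] at h7
  have h8 : c n * (s * Real.exp (-s)) ^ n ≤ A (s * Real.exp (-s)) := by
    simp only [hA, hN]
    rw [Finset.sum_range_succ]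
    have : 0 ≤ ∑ k ∈ Finset.range n, c k * (s * Real.exp (-s)) ^ k :=
      Finset.sum_nonneg (fun k _ => mul_nonneg (hc k) (by positivity))
    linarith
  refine h8.trans ?_
  rw [Real.exp_neg ((s - s ^ 2 / 2) / y), ← div_eq_mul_inv, div_le_one (Real.exp_pos _)] at h7
  exact h7

end RC

namespace RC

def hh (s v : ℝ) : ℝ := s - s ^ 2 / 2 + v * (s - Real.log s)
def gg (v : ℝ) : ℝ := hh (min v 1) v
def GG (v : ℝ) : ℝ := min v 1 - Real.log (min v 1)
def W0 (s : ℝ) : ℝ := min s 1 * Real.exp (-(min s 1))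

lemma W0_cont : Continuous W0 := by unfold W0; fun_prop

lemma W0_eq {s : ℝ} (hs : 0 < s) : W0 s = Real.exp (-GG s) := by
  have : 0 < min s 1 := lt_min hs one_pos
  unfold W0 GG
  rw [neg_sub, sub_eq_add_neg, Real.exp_add, Real.exp_log this]

lemma hh_deriv (v : ℝ) {s : ℝ} (hs : 0 < s) :
    HasDerivAt (fun s => hh s v) ((1 - s) * (s - v) / s) s := by
  have h : HasDerivAt (fun s => hh s v) (1 - (2 : ℕ) * s ^ (2 - 1) / 2 + v * (1 - s⁻¹)) s :=
    ((hasDerivAt_id s).sub ((hasDerivAt_pow 2 s).div_const 2)).add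
      (((hasDerivAt_id s).sub (Real.hasDerivAt_log hs.ne')).const_mul v)
  convert h using 1
  field_simp
  push_cast
  ring

lemma hh_anti {v a b : ℝ} (ha : 0 < a) (hab : a ≤ b) (hb : b ≤ 1) (hbv : b ≤ v) :
    hh b v ≤ hh a v := by
  have : AntitoneOn (fun s => hh s v) (Icc a b) := by
    apply antitoneOn_of_deriv_nonpos (convex_Icc a b)
    · exact fun x hx => (hh_deriv v (ha.trans_le hx.1)).continuousAt.continuousWithinAt
    · intro x hx
      rw [interior_Icc] at hx
      exact (hh_deriv v (ha.trans hx.1)).differentiableAt.differentiableWithinAt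
    · intro x hx
      rw [interior_Icc] at hx
      have h0 := ha.trans hx.1
      rw [(hh_deriv v h0).deriv]
      apply div_nonpos_of_nonpos_of_nonneg _ h0.le
      have := hx.2
      nlinarith
  exact this (left_mem_Icc.2 hab) (right_mem_Icc.2 hab) hab

lemma hh_mono {v a b : ℝ} (ha : 0 < a) (hab : a ≤ b) (hb : b ≤ 1) (hbv : v ≤ a) :
    hh a v ≤ hh b v := by
  have : MonotoneOn (fun s => hh s v) (Icc a b) := by
    apply monotoneOn_of_deriv_nonneg (convex_Icc a b)
    · exact fun x hx => (hh_deriv v (ha.trans_le hx.1)).continuousAt.continuousWithinAt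
    · intro x hx
      rw [interior_Icc] at hx
      exact (hh_deriv v (ha.trans hx.1)).differentiableAt.differentiableWithinAt
    · intro x hx
      rw [interior_Icc] at hx
      have h0 := ha.trans hx.1
      rw [(hh_deriv v h0).deriv]
      apply div_nonneg _ h0.le
      have := hx.2
      have := hx.1
      apply mul_nonneg <;> linarith
  exact this (left_mem_Icc.2 hab) (right_mem_Icc.2 hab) hab

lemma GG_ge {v : ℝ} (hv : 0 < v) : 1 ≤ GG v := by
  have : 0 < min v 1 := lt_min hv one_pos
  have := Real.log_le_sub_one_of_pos this
  unfold GG; linarith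

lemma GG_anti {u v : ℝ} (hu : 0 < u) (huv : u ≤ v) : GG v ≤ GG u := by
  unfold GG
  have ha : 0 < min u 1 := lt_min hu one_pos
  have hab : min u 1 ≤ min v 1 := min_le_min_right 1 huv
  have hb : min v 1 ≤ 1 := min_le_right _ _
  set a := min u 1
  set b := min v 1
  have hb0 : 0 < b := ha.trans_le hab
  have h1 := Real.log_le_sub_one_of_pos (div_pos ha hb0)
  rw [Real.log_div ha.ne' hb0.ne'] at h1
  have h2 : b - a ≤ 1 - a / b := by
    have : 1 - a / b = (b - a) / b := by field_simp
    rw [this, le_div_iff₀ hb0]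
    nlinarith
  linarith

lemma gg_concave {u v : ℝ} (hu : 0 < u) (huv : u ≤ v) : gg v - gg u ≤ (v - u) * GG u := by
  have ha : 0 < min u 1 := lt_min hu one_pos
  have h := hh_anti (v := v) ha (min_le_min_right 1 huv) (min_le_right _ _) (min_le_left _ _)
  have : hh (min u 1) v = gg u + (v - u) * GG u := by
    unfold gg GG hh; ring
  unfold gg at *
  linarith

lemma gg_mono {u v : ℝ} (hu : 0 < u) (huv : u ≤ v) : gg u ≤ gg v := by
  have hv : 0 < v := hu.trans_le huv
  have h1 : hh (min v 1) u ≤ gg v := by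
    have : gg v = hh (min v 1) u + (v - u) * GG v := by unfold gg GG hh; ring
    have := GG_ge hv
    nlinarith
  refine le_trans ?_ h1
  unfold gg
  rcases le_total u 1 with h | h
  · rw [min_eq_left h]
    exact hh_mono hu (le_min huv h) (min_le_right _ _) le_rfl
  · rw [min_eq_right h, min_eq_right (h.trans huv)]

lemma gg_tendsto : Tendsto gg (𝓝[>] 0) (𝓝 0) := by
  have h : Tendsto (fun v : ℝ => v - v ^ 2 / 2 + v * v - v * Real.log v) (𝓝 0) (𝓝 0) := by
    have := Real.continuous_mul_log
    have h2 : Continuous (fun v : ℝ => v - v ^ 2 / 2 + v * v - v * Real.log v) := by fun_prop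
    have := h2.tendsto 0
    simpa using this
  refine (h.mono_left nhdsWithin_le_nhds).congr' ?_
  have h1 : Iio (1 : ℝ) ∈ 𝓝[>] (0 : ℝ) := mem_nhdsWithin_of_mem_nhds (Iio_mem_nhds one_pos)
  filter_upwards [h1] with v hv
  unfold gg hh
  rw [min_eq_left (le_of_lt hv)]; ring

lemma Psi_aux {x : ℝ} (hx : 0 < x) : HasDerivAt (fun x : ℝ => Real.log x - (x - 1 / x) / 2)
    (-(1 - x⁻¹) ^ 2 / 2) x := by
  have : HasDerivAt (fun x : ℝ => Real.log x - (x - x⁻¹) / 2) (x⁻¹ - (1 - -(x ^ 2)⁻¹) / 2) x :=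
    (Real.hasDerivAt_log hx.ne').sub
      (((hasDerivAt_id x).sub (hasDerivAt_inv hx.ne')).div_const 2)
  simp only [one_div]
  convert this using 1
  field_simp
  ring

lemma Psi_eq {x : ℝ} (hx : 0 < x) : Psi x + x / 2 = gg x / x + Real.log x - 1 := by
  have hanti : AntitoneOn (fun x : ℝ => Real.log x - (x - 1 / x) / 2) (Ioi 0) := by
    apply antitoneOn_of_deriv_nonpos (convex_Ioi 0)
    · exact fun x hx => (Psi_aux hx).continuousAt.continuousWithinAt
    · intro x hx
      rw [interior_Ioi] at hx
      exact (Psi_aux hx).differentiableAt.differentiableWithinAt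
    · intro x hx
      rw [interior_Ioi] at hx
      rw [(Psi_aux hx).deriv]
      have := sq_nonneg (1 - x⁻¹)
      linarith
  unfold Psi gg hh
  rcases le_total x 1 with h | h
  · have := hanti hx (show (1 : ℝ) ∈ Ioi 0 from Set.mem_Ioi.2 one_pos) h
    simp only [Real.log_one] at this
    rw [min_eq_right (by linarith), min_eq_left h]
    field_simp
    ring
  · have := hanti (show (1 : ℝ) ∈ Ioi 0 from Set.mem_Ioi.2 one_pos) hx h
    simp only [Real.log_one] at this
    rw [min_eq_left (by linarith), min_eq_right h, Real.log_one]
    field_simp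
    ring

/-- normalised forest polynomial -/
def aa (r n : ℕ) (y : ℝ) : ℝ := PP r n y / (n.factorial * y ^ n)

lemma PP_nonneg (r n : ℕ) {y : ℝ} (hy : 0 ≤ y) : 0 ≤ PP r n y :=
  finsum_nonneg (fun _ => pow_nonneg hy _)

lemma aa_nonneg (r n : ℕ) {y : ℝ} (hy : 0 ≤ y) : 0 ≤ aa r n y :=
  div_nonneg (PP_nonneg r n hy) (by positivity)

lemma aa_zero (r : ℕ) (y : ℝ) : aa r 0 y = 1 := by simp [aa, PP_zero]

lemma aa_rec (r n : ℕ) {y : ℝ} (hy : 0 < y) : ((n : ℝ) + 1) * y * aa r (n + 1) y =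
    ∑ i ∈ Finset.range (n + 1), if i < r then mm i * aa r (n - i) y else 0 := by
  have h := PP_rec r n y
  unfold aa
  rw [h, Nat.factorial_succ]
  have hn : (n.factorial : ℝ) ≠ 0 := by positivity
  have e : ∀ S : ℝ, ((n : ℝ) + 1) * y * (S / (((n + 1) * n.factorial : ℕ) * y ^ (n + 1))) =
    S * (1 / (n.factorial * y ^ n)) := by
    intro S
    push_cast
    rw [pow_succ]
    field_simp
  rw [e, Finset.sum_mul]
  refine Finset.sum_congr rfl (fun i hi => ?_)
  have hi' : i ≤ n := by simpa [Nat.lt_succ_iff] using hi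
  split_ifs
  · obtain ⟨j, rfl⟩ := Nat.exists_eq_add_of_le hi'
    rw [show i + j - i = j by omega, tc_eq]
    have h4 := Nat.add_choose_mul_factorial_mul_factorial i j
    rw [← Nat.choose_symm_add] at h4
    have h5 : ((i + j).choose i : ℝ) * i.factorial * j.factorial = (i + j).factorial := by
      exact_mod_cast h4
    rw [← h5, pow_add]
    have : ((i + j).choose i : ℝ) ≠ 0 := by
      exact_mod_cast (Nat.choose_pos (Nat.le_add_right i j)).ne'
    field_simp
  · simp

/-- upper bound -/
lemma aa_upper (r n : ℕ) {y : ℝ} (hy : 0 < y) (hn : 0 < n) :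
    aa r n y ≤ Real.exp (gg (n * y) / y) := by
  have hv : 0 < (n : ℝ) * y := by positivity
  have hs : 0 < min ((n : ℝ) * y) 1 := lt_min hv one_pos
  have h := chernoff y hy (fun n => aa r n y) (fun n => aa_nonneg r n hy.le) (aa_zero r y)
    (fun n => by
      rw [aa_rec r n hy]
      refine Finset.sum_le_sum (fun i _ => ?_)
      split_ifs
      · exact le_rfl
      · exact mul_nonneg (mm_nonneg i) (aa_nonneg r _ hy.le)) hs.le (min_le_right _ _) n
  unfold gg hh
  set s := min ((n : ℝ) * y) 1
  have e : (s - s ^ 2 / 2 + n * y * (s - Real.log s)) / y =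
    (s - s ^ 2 / 2) / y + n * (s - Real.log s) := by field_simp
  rw [e, Real.exp_add]
  have e2 : (s * Real.exp (-s)) = Real.exp (-(s - Real.log s)) := by
    rw [neg_sub, sub_eq_add_neg, Real.exp_add, Real.exp_log hs]
  rw [e2, ← Real.exp_nat_mul, mul_neg, Real.exp_neg, ← div_eq_mul_inv,
    div_le_iff₀ (Real.exp_pos _)] at h
  exact h

end RC

namespace RC

lemma mm_bound {w X : ℝ} (hw : 0 < w) (hX : ∀ N, MM N w ≤ X) (k : ℕ) : mm k ≤ X / w ^ k := by
  rw [le_div_iff₀ (by positivity)]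
  refine le_trans ?_ (hX (k + 1))
  unfold MM
  exact Finset.single_le_sum (f := fun k => mm k * w ^ k)
    (fun i _ => mul_nonneg (mm_nonneg i) (by positivity)) (Finset.self_mem_range_succ k)

lemma summ1 {w X x : ℝ} (hw : 0 < w) (hX : ∀ N, MM N w ≤ X) (hx : |x| < w) :
    Summable (fun k : ℕ => ((k : ℝ) + 1) * mm k * |x| ^ k) := by
  have hX0 : 0 ≤ X := (MM_nonneg 0 hw.le).trans (hX 0)
  have hr : |x| / w < 1 := (div_lt_one hw).2 hx
  have hr0 : 0 ≤ |x| / w := by positivity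
  have hn : ‖|x| / w‖ < 1 := by rwa [Real.norm_of_nonneg hr0]
  have h1 := summable_pow_mul_geometric_of_norm_lt_one 1 hn
  have h0 := summable_geometric_of_lt_one hr0 hr
  have := (h1.add h0).mul_left X
  refine Summable.of_nonneg_of_le (fun k => by have := mm_nonneg k; positivity) (fun k => ?_) this
  have hb := mm_bound hw hX k
  calc ((k : ℝ) + 1) * mm k * |x| ^ k ≤ ((k : ℝ) + 1) * (X / w ^ k) * |x| ^ k := by gcongr
    _ = X * ((k : ℝ) ^ 1 * (|x| / w) ^ k + (|x| / w) ^ k) := by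
      rw [div_pow]; field_simp

lemma MM_limit {w X : ℝ} (hw : 0 < w) (hX : ∀ N, MM N w ≤ X) {x : ℝ} (hx0 : 0 < x) (hxw : x < w) :
    ∃ μ, 0 < μ ∧ Tendsto (fun N => MM N x) atTop (𝓝 μ) ∧ x * μ < 1 ∧
      μ * Real.exp (-(x * μ)) = 1 := by
  set M : ℝ → ℝ := fun z => ∑' k, mm k * z ^ k with hM
  set M' : ℝ → ℝ := fun z => ∑' k : ℕ, mm k * (k * z ^ (k - 1)) with hM'
  have s1 : ∀ z, |z| < w → Summable (fun k : ℕ => ((k : ℝ) + 1) * mm k * |z| ^ k) :=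
    fun z hz => summ1 hw hX hz
  have s0 : ∀ z, |z| < w → Summable (fun k : ℕ => mm k * |z| ^ k) := by
    intro z hz
    refine Summable.of_nonneg_of_le (fun k => mul_nonneg (mm_nonneg k) (by positivity))
      (fun k => ?_) (s1 z hz)
    have : 0 ≤ mm k * |z| ^ k := mul_nonneg (mm_nonneg k) (by positivity)
    nlinarith [(Nat.cast_nonneg k : (0 : ℝ) ≤ k)]
  have n0 : ∀ z, |z| < w → Summable (fun k : ℕ => ‖mm k * z ^ k‖) := by
    intro z hz
    refine (s0 z hz).congr (fun k => ?_)
    rw [norm_mul, norm_pow, Real.norm_of_nonneg (mm_nonneg k), Real.norm_eq_abs]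
  have n1 : ∀ z, |z| < w → Summable (fun k : ℕ => ‖((k : ℝ) + 1) * mm k * z ^ k‖) := by
    intro z hz
    refine (s1 z hz).congr (fun k => ?_)
    rw [norm_mul, norm_mul, norm_pow, Real.norm_of_nonneg (mm_nonneg k), Real.norm_eq_abs z,
      Real.norm_of_nonneg (by positivity)]
  have sd : ∀ z, |z| < w → Summable (fun k : ℕ => mm k * (k * |z| ^ (k - 1))) := by
    intro z hz
    obtain ⟨t, ht1, ht2⟩ := exists_between hz
    have ht0 : 0 < t := (abs_nonneg z).trans_lt ht1
    have := (s1 t (by rwa [abs_of_pos ht0])).mul_left (1 / t)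
    refine Summable.of_nonneg_of_le (fun k => mul_nonneg (mm_nonneg k) (by positivity))
      (fun k => ?_) this
    rcases k with _ | k
    · have := mm_nonneg 0
      simp; positivity
    · have h3 := mm_nonneg (k + 1)
      rw [abs_of_pos ht0]
      simp only [Nat.add_sub_cancel, Nat.cast_add, Nat.cast_one]
      calc mm (k + 1) * (((k : ℝ) + 1) * |z| ^ k) ≤ mm (k + 1) * (((k : ℝ) + 1 + 1) * t ^ k) := by
            gcongr; linarith
        _ = _ := by rw [pow_succ]; field_simp
  have hMd : ∀ z, |z| < w → HasDerivAt M (M' z) z := by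
    intro z hz
    obtain ⟨t, ht1, ht2⟩ := exists_between hz
    have ht0 : 0 < t := (abs_nonneg z).trans_lt ht1
    refine hasDerivAt_tsum_of_isPreconnected (t := Ioo (-t) t) (y₀ := 0)
      (sd t (by rwa [abs_of_pos ht0])) isOpen_Ioo isPreconnected_Ioo
      (fun k y _ => (hasDerivAt_pow k y).const_mul _) ?_ ⟨by linarith, ht0⟩ ?_ (abs_lt.1 ht1)
    · intro k y hy
      have hy' : |y| < t := abs_lt.2 hy
      rw [norm_mul, norm_mul, norm_pow, Real.norm_of_nonneg (mm_nonneg k), Real.norm_eq_abs y,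
        Real.norm_of_nonneg (Nat.cast_nonneg k), abs_of_pos ht0]
      have := mm_nonneg k
      gcongr
    · exact (n0 0 (by simpa using hw)).of_norm
  have hode : ∀ z, |z| < w → M' z = M z * (M z + z * M' z) := by
    intro z hz
    have sd' : Summable (fun k : ℕ => mm k * (k * z ^ (k - 1))) := by
      apply Summable.of_norm
      refine (sd z hz).congr (fun k => ?_)
      rw [norm_mul, norm_mul, norm_pow, Real.norm_of_nonneg (mm_nonneg k), Real.norm_eq_abs z,
        Real.norm_of_nonneg (Nat.cast_nonneg k)]
    have h1 : M z + z * M' z = ∑' k : ℕ, ((k : ℝ) + 1) * mm k * z ^ k := by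
      simp only [hM, hM']
      rw [← tsum_mul_left, ← ((n0 z hz).of_norm).tsum_add (sd'.mul_left z)]
      refine tsum_congr (fun k => ?_)
      rcases k with _ | k
      · simp
      · simp [pow_succ]; ring
    rw [h1]
    simp only [hM, hM']
    rw [tsum_mul_tsum_eq_tsum_sum_range_of_summable_norm (n0 z hz) (n1 z hz),
      sd'.tsum_eq_zero_add]
    simp only [Nat.cast_zero, zero_mul, mul_zero, zero_add, Nat.add_sub_cancel]
    refine tsum_congr (fun k => ?_)
    have := mm_rec k
    have e : mm (k + 1) * (((k + 1 : ℕ) : ℝ) * z ^ k) = (((k : ℝ) + 1) * mm (k + 1)) * z ^ k := by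
      push_cast; ring
    rw [e, this, Finset.sum_mul]
    refine Finset.sum_congr rfl (fun i hi => ?_)
    have hi' : i ≤ k := by simpa [Nat.lt_succ_iff] using hi
    have : z ^ k = z ^ i * z ^ (k - i) := by rw [← pow_add]; congr 1; omega
    rw [this]
    ring
  have hM0 : M 0 = 1 := by
    simp only [hM]
    rw [tsum_eq_single 0]
    · simp [mm_zero]
    · intro k hk; simp [hk]
  have hconst : ∀ z, |z| < w → M z * Real.exp (-(z * M z)) = 1 := by
    intro z hz
    have hd : ∀ x, |x| < w → HasDerivAt (fun w => M w * Real.exp (-(w * M w))) 0 x := by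
      intro x hx
      have : HasDerivAt (fun w => M w * Real.exp (-(w * M w)))
        (M' x * Real.exp (-(x * M x)) + M x * (Real.exp (-(x * M x)) *
        (-(1 * M x + x * M' x)))) x :=
        (hMd x hx).mul ((((hasDerivAt_id x).mul (hMd x hx)).neg).exp)
      convert this using 1
      have := hode x hx
      have e : M' x * Real.exp (-(x * M x)) + M x * (Real.exp (-(x * M x)) *
        (-(1 * M x + x * M' x))) = (M' x - M x * (M x + x * M' x)) * Real.exp (-(x * M x)) := by
        ring
      rw [e, ← this]; ring
    have := isOpen_Ioo.is_const_of_deriv_eq_zero (s := Ioo (-w) w) isPreconnected_Ioo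
      (f := fun w => M w * Real.exp (-(w * M w)))
      (fun x hx => (hd x (abs_lt.2 hx)).differentiableAt.differentiableWithinAt)
      (fun x hx => (hd x (abs_lt.2 hx)).deriv) (abs_lt.1 hz)
      (show (0 : ℝ) ∈ Ioo (-w) w from ⟨by linarith, hw⟩)
    simpa [hM0] using this
  have hpos : ∀ z, |z| < w → 0 < M z := by
    intro z hz
    have h1 := hconst z hz
    have h2 := Real.exp_pos (-(z * M z))
    by_contra! h
    nlinarith
  have hne1 : ∀ z, |z| < w → z * M z ≠ 1 := by
    intro z hz h
    have h1 := hode z hz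
    have h2 := hpos z hz
    have : M z * (M z + z * M' z) = M z ^ 2 + (z * M z) * M' z := by ring
    rw [this, h] at h1
    nlinarith
  have hxa : |x| < w := by rwa [abs_of_pos hx0]
  refine ⟨M x, hpos x hxa, ?_, ?_, hconst x hxa⟩
  · exact ((n0 x hxa).of_norm).hasSum.tendsto_sum_nat
  · by_contra! h
    have hc : ContinuousOn (fun z => z * M z) (Icc 0 x) := by
      intro z hz
      have : |z| < w := by rw [abs_of_nonneg hz.1]; exact hz.2.trans_lt hxw
      exact (continuousAt_id.mul (hMd z this).continuousAt).continuousWithinAt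
    obtain ⟨z, hz, hz1⟩ := intermediate_value_Icc hx0.le hc
      (show (1 : ℝ) ∈ Icc _ _ from ⟨by simp, h⟩)
    exact hne1 z (by rw [abs_of_nonneg hz.1]; exact hz.2.trans_lt hxw) hz1

lemma xexp_mono {a b : ℝ} (ha : 0 < a) (hab : a ≤ b) (hb : b ≤ 1) :
    a * Real.exp (-a) ≤ b * Real.exp (-b) := by
  have h := GG_anti ha hab
  have h1 := W0_eq ha
  have h2 := W0_eq (ha.trans_le hab)
  have : W0 a ≤ W0 b := by rw [h1, h2]; exact Real.exp_le_exp.2 (by linarith)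
  unfold W0 at this
  rwa [min_eq_left hb, min_eq_left (hab.trans hb)] at this

lemma MM_mono_N {N N' : ℕ} (h : N ≤ N') {w : ℝ} (hw : 0 ≤ w) : MM N w ≤ MM N' w :=
  Finset.sum_le_sum_of_subset_of_nonneg (Finset.range_subset_range.2 h)
    (fun k _ _ => mul_nonneg (mm_nonneg k) (by positivity))

lemma W0_pos {s : ℝ} (hs : 0 < s) : 0 < W0 s := by rw [W0_eq hs]; exact Real.exp_pos _

lemma MM_exceeds {δ s : ℝ} (hδ : 0 < δ) (hs : 0 < s) :
    ∃ N, s < ((1 + δ) * W0 s) * MM N ((1 + δ) * W0 s) := by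
  by_contra! h
  have hW := W0_pos hs
  set w := (1 + δ) * W0 s with hw
  have hw0 : 0 < w := by positivity
  have hX : ∀ N, MM N w ≤ s / w := fun N => by
    rw [le_div_iff₀ hw0, mul_comm]; exact h N
  have hlt : W0 s < w := by nlinarith
  obtain ⟨x, hx1, hx2⟩ := exists_between hlt
  have hx0 := hW.trans hx1
  obtain ⟨μ, hμ, ht, h1, h2⟩ := MM_limit hw0 hX hx0 hx2
  have hle : x * μ ≤ s := by
    refine le_of_tendsto (ht.const_mul x) (Eventually.of_forall (fun N => ?_))
    refine le_trans ?_ (h N)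
    exact mul_le_mul hx2.le (MM_mono N hx0.le hx2.le) (MM_nonneg N hx0.le) hw0.le
  have h3 := xexp_mono (mul_pos hx0 hμ) (le_min hle h1.le) (min_le_right s 1)
  rw [mul_assoc, h2, mul_one] at h3
  unfold W0 at hx1
  linarith

lemma MM_unif {δ : ℝ} (hδ : 0 < δ) (X : ℝ) : ∃ r0 : ℕ, ∀ r ≥ r0, ∀ s ∈ Icc δ X,
    s ≤ ((1 + δ) * W0 s) * MM r ((1 + δ) * W0 s) := by
  obtain ⟨r0, h⟩ := (isCompact_Icc (a := δ) (b := X)).elim_directed_cover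
    (fun N : ℕ => {s : ℝ | s < ((1 + δ) * |W0 s|) * MM N ((1 + δ) * |W0 s|)})
    (fun N => isOpen_lt continuous_id (by
      have := W0_cont
      have := MM_cont N
      fun_prop))
    (fun s hs => by
      have hs0 := hδ.trans_le hs.1
      obtain ⟨N, hN⟩ := MM_exceeds hδ hs0
      refine mem_iUnion.2 ⟨N, ?_⟩
      simp only [mem_setOf_eq]
      rwa [abs_of_pos (W0_pos hs0)])
    (directed_of_isDirected_le (fun N N' hN s hs => by
      simp only [mem_setOf_eq] at *
      refine hs.trans_le ?_
      have : 0 ≤ (1 + δ) * |W0 s| := by positivity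
      exact mul_le_mul_of_nonneg_left (MM_mono_N hN this) this))
  refine ⟨r0, fun r hr s hs => ?_⟩
  have h1 := h hs
  simp only [mem_setOf_eq] at h1
  rw [abs_of_pos (W0_pos (hδ.trans_le hs.1))] at h1
  have h0 := W0_pos (hδ.trans_le hs.1)
  have h2 : 0 ≤ (1 + δ) * W0 s := by positivity
  exact h1.le.trans (mul_le_mul_of_nonneg_left (MM_mono_N hr h2) h2)

end RC

namespace RC
open SimpleGraph

lemma bot_FO (r n : ℕ) (hr : 1 ≤ r) : (⊥ : SimpleGraph (Fin n)).IsAcyclic ∧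
    ∀ v, ((⊥ : SimpleGraph (Fin n)).connectedComponentMk v).supp.ncard ≤ r := by
  refine ⟨isAcyclic_bot, fun v => ?_⟩
  have : ((⊥ : SimpleGraph (Fin n)).connectedComponentMk v).supp = {v} := by
    ext w
    simp [ConnectedComponent.mem_supp_iff, ConnectedComponent.eq]
  rw [this, ncard_singleton]; exact hr

lemma one_le_PP (r n : ℕ) (hr : 1 ≤ r) {y : ℝ} (hy : 0 ≤ y) : 1 ≤ PP r n y := by
  have i1 : Fintype (FO r (Fin n)) := Fintype.ofFinite _
  rw [PP, FS, finsum_eq_sum_of_fintype]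
  have := Finset.single_le_sum (f := fun G : FO r (Fin n) => y ^ G.1.edgeSet.ncard)
    (fun i _ => pow_nonneg hy _) (Finset.mem_univ (⟨⊥, bot_FO r n hr⟩ : FO r (Fin n)))
  simpa using this

lemma aa_lower {δ X : ℝ} (hδ : 0 < δ) {r : ℕ} (hr : 1 ≤ r)
    (hX : ∀ s ∈ Icc δ X, s ≤ ((1 + δ) * W0 s) * MM r ((1 + δ) * W0 s))
    {y : ℝ} (hy : 0 < y) (hy1 : y ≤ 1) (hry : r * y ≤ δ) (n : ℕ) (hn : n * y + δ ≤ X) :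
    Real.exp (-(r * GG δ)) / r.factorial *
      Real.exp ((gg (n * y + δ) - gg δ) / y - n * Real.log (1 + δ)) ≤ aa r n y := by
  induction n using Nat.strong_induction_on with
  | _ n ih =>
  have hl : 0 ≤ Real.log (1 + δ) := Real.log_nonneg (by linarith)
  rcases lt_or_ge n r with hnr | hnr
  · have hg := gg_concave hδ (show δ ≤ n * y + δ by nlinarith [(Nat.cast_nonneg n : (0 : ℝ) ≤ n)])
    have hG := GG_ge hδ
    have h1 : (gg (n * y + δ) - gg δ) / y ≤ r * GG δ := by
      rw [div_le_iff₀ hy]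
      refine hg.trans ?_
      have : (n : ℝ) ≤ r := by exact_mod_cast hnr.le
      have : (n : ℝ) * y + δ - δ ≤ r * y := by nlinarith
      nlinarith
    have h2 : Real.exp ((gg (n * y + δ) - gg δ) / y - n * Real.log (1 + δ)) ≤
        Real.exp (r * GG δ) := by
      apply Real.exp_le_exp.2
      have : 0 ≤ (n : ℝ) * Real.log (1 + δ) := by positivity
      linarith
    calc Real.exp (-(r * GG δ)) / r.factorial *
      Real.exp ((gg (n * y + δ) - gg δ) / y - n * Real.log (1 + δ))
        ≤ Real.exp (-(r * GG δ)) / r.factorial * Real.exp (r * GG δ) := by gcongr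
      _ = 1 / r.factorial := by
        rw [Real.exp_neg]; field_simp
      _ ≤ 1 / n.factorial := by
        apply one_div_le_one_div_of_le (by positivity)
        exact_mod_cast Nat.factorial_le hnr.le
      _ ≤ aa r n y := by
        unfold aa
        have h3 : (n.factorial : ℝ) * y ^ n ≤ n.factorial :=
          mul_le_of_le_one_right (by positivity) (pow_le_one₀ hy.le hy1)
        have := one_le_PP r n hr hy.le
        gcongr
  · obtain ⟨m, rfl⟩ : ∃ m, n = m + 1 := ⟨n - 1, by omega⟩
    set K := Real.exp (-(r * GG δ)) / r.factorial with hK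
    have hK0 : 0 < K := by positivity
    set b : ℕ → ℝ := fun n => (gg (n * y + δ) - gg δ) / y - n * Real.log (1 + δ) with hb
    set s : ℝ := ((m + 1 : ℕ) - r : ℝ) * y + δ with hs
    have hrm : (r : ℝ) ≤ (m + 1 : ℕ) := by exact_mod_cast hnr
    have hδs : δ ≤ s := by
      have : 0 ≤ (((m + 1 : ℕ) : ℝ) - r) * y := mul_nonneg (by linarith) hy.le
      linarith
    have hs0 := hδ.trans_le hδs
    have hsX : s ≤ X := by
      have : 0 ≤ (r : ℝ) * y := by positivity
      nlinarith
    have hmain := hX s ⟨hδs, hsX⟩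
    set w := (1 + δ) * W0 s with hw
    have hwe : w = Real.exp (-(GG s - Real.log (1 + δ))) := by
      rw [hw, W0_eq hs0, neg_sub, sub_eq_add_neg, Real.exp_add, Real.exp_log (by linarith)]
    have hterm : ∀ i < r, K * Real.exp (b (m + 1)) * w ^ (i + 1) ≤ aa r (m - i) y := by
      intro i hi
      have hj : ((m - i : ℕ) : ℝ) = (m + 1 : ℕ) - (i + 1 : ℝ) := by
        rw [Nat.cast_sub (by omega)]; push_cast; ring
      have hir : (i : ℝ) + 1 ≤ r := by exact_mod_cast hi
      have hsj : s ≤ (m - i : ℕ) * y + δ := by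
        rw [hj, hs]
        nlinarith
      have hjn : ((m - i : ℕ) : ℝ) * y + δ ≤ (m + 1 : ℕ) * y + δ := by
        rw [hj]
        have : 0 ≤ (i : ℝ) + 1 := by positivity
        nlinarith
      have h1 := ih (m - i) (by omega) (hjn.trans hn)
      refine le_trans ?_ h1
      rw [hwe, ← Real.exp_nat_mul, mul_assoc, ← Real.exp_add]
      apply mul_le_mul_of_nonneg_left _ hK0.le
      apply Real.exp_le_exp.2
      have h2 := gg_concave (hs0.trans_le hsj) hjn
      have h3 := GG_anti hs0 hsj
      have h4 : (((m + 1 : ℕ) : ℝ) * y + δ) - ((m - i : ℕ) * y + δ) = (i + 1) * y := by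
        rw [hj]; ring
      rw [h4] at h2
      have h5 : (gg ((m + 1 : ℕ) * y + δ) - gg ((m - i : ℕ) * y + δ)) / y ≤ (i + 1) * GG s := by
        rw [div_le_iff₀ hy]
        refine h2.trans ?_
        have : 0 ≤ ((i : ℝ) + 1) * y := by positivity
        nlinarith
      have e : (gg ((m + 1 : ℕ) * y + δ) - gg ((m - i : ℕ) * y + δ)) / y =
        (gg ((m + 1 : ℕ) * y + δ) - gg δ) / y - (gg ((m - i : ℕ) * y + δ) - gg δ) / y := by ring
      rw [e] at h5
      simp only [hb]
      have e2 : ((m - i : ℕ) : ℝ) * Real.log (1 + δ) = (m + 1 : ℕ) * Real.log (1 + δ) -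
        (i + 1) * Real.log (1 + δ) := by rw [hj]; ring
      rw [e2]
      push_cast at h5 ⊢
      linarith
    have hrec := aa_rec r m hy
    have hsum : ∑ i ∈ Finset.range r, mm i * aa r (m - i) y =
        ∑ i ∈ Finset.range (m + 1), if i < r then mm i * aa r (m - i) y else 0 := by
      rw [← Finset.sum_filter]
      refine Finset.sum_congr ?_ (fun _ _ => rfl)
      ext i; simp only [Finset.mem_range, Finset.mem_filter]; omega
    rw [← hsum] at hrec
    have hlow : K * Real.exp (b (m + 1)) * s ≤ ((m : ℝ) + 1) * y * aa r (m + 1) y := by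
      rw [hrec]
      calc K * Real.exp (b (m + 1)) * s ≤ K * Real.exp (b (m + 1)) * (w * MM r w) := by gcongr
        _ = ∑ i ∈ Finset.range r, mm i * (K * Real.exp (b (m + 1)) * w ^ (i + 1)) := by
          unfold MM
          rw [Finset.mul_sum, Finset.mul_sum]
          refine Finset.sum_congr rfl (fun i _ => by ring)
        _ ≤ _ := by
          refine Finset.sum_le_sum (fun i hi => ?_)
          exact mul_le_mul_of_nonneg_left (hterm i (Finset.mem_range.1 hi)) (mm_nonneg i)
    have hny : ((m : ℝ) + 1) * y ≤ s := by
      rw [hs]; push_cast; nlinarith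
    have hpos : 0 < ((m : ℝ) + 1) * y := by positivity
    have hfin : K * Real.exp (b (m + 1)) * (((m : ℝ) + 1) * y) ≤
        aa r (m + 1) y * (((m : ℝ) + 1) * y) := by
      calc _ ≤ K * Real.exp (b (m + 1)) * s := by gcongr
        _ ≤ _ := hlow
        _ = _ := by ring
    exact le_of_mul_le_mul_right hfin hpos

lemma log_fact_le (n : ℕ) (hn : 1 ≤ n) :
    Real.log n.factorial ≤ ((n : ℝ) + 1) * Real.log n + 1 - n := by
  induction n, hn using Nat.le_induction with
  | base => simp
  | succ n hn ih =>
    have hn0 : (0 : ℝ) < n := by exact_mod_cast hn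
    rw [Nat.factorial_succ]
    push_cast
    rw [Real.log_mul (by positivity) (by positivity)]
    have h1 := Real.log_le_sub_one_of_pos (show 0 < (n : ℝ) / (n + 1) by positivity)
    rw [Real.log_div hn0.ne' (by positivity)] at h1
    have h2 : (n : ℝ) / (n + 1) - 1 = -(1 / (n + 1)) := by field_simp; ring
    rw [h2] at h1
    have h3 : ((n : ℝ) + 1) * (Real.log n - Real.log (n + 1)) ≤ (n + 1) * (-(1 / (n + 1))) :=
      mul_le_mul_of_nonneg_left h1 (by positivity)
    have h4 : ((n : ℝ) + 1) * (-(1 / (n + 1))) = -1 := by field_simp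
    rw [h4] at h3
    linarith

lemma log_fact_ge (n : ℕ) (hn : 1 ≤ n) :
    (n : ℝ) * Real.log n - n ≤ Real.log n.factorial := by
  have hn0 : (0 : ℝ) < n := by exact_mod_cast hn
  have h := Real.pow_div_factorial_le_exp (n : ℝ) hn0.le n
  have h2 := Real.log_le_log (by positivity) h
  rw [Real.log_exp, Real.log_div (by positivity) (by positivity), Real.log_pow] at h2
  linarith

lemma log_PP (r n : ℕ) (hr : 1 ≤ r) (hn : 1 ≤ n) {x : ℝ} (hx : 0 < x) :
    Real.log (PP r n (x / n)) = Real.log (aa r n (x / n)) + Real.log n.factorial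
      + n * Real.log x - n * Real.log n := by
  have hn0 : (0 : ℝ) < n := by exact_mod_cast hn
  have hy : 0 < x / n := by positivity
  have h1 : 0 < PP r n (x / n) := one_pos.trans_le (one_le_PP r n hr hy.le)
  unfold aa
  rw [Real.log_div h1.ne' (by positivity), Real.log_mul (by positivity) (by positivity),
    Real.log_pow, Real.log_div hx.ne' hn0.ne']
  ring

lemma PP_upper (r n : ℕ) (hr : 1 ≤ r) (hn : 1 ≤ n) {x : ℝ} (hx : 0 < x) :
    Real.log (PP r n (x / n)) ≤ n * (Psi x + x / 2) + Real.log n + 1 := by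
  have hn0 : (0 : ℝ) < n := by exact_mod_cast hn
  have hy : 0 < x / n := by positivity
  have h1 : 0 < PP r n (x / n) := one_pos.trans_le (one_le_PP r n hr hy.le)
  have ha : 0 < aa r n (x / n) := by unfold aa; positivity
  have h2 := aa_upper r n hy hn
  rw [show (n : ℝ) * (x / n) = x by field_simp] at h2
  have h3 := Real.log_le_log ha h2
  rw [Real.log_exp] at h3
  rw [log_PP r n hr hn hx, Psi_eq hx]
  have h4 := log_fact_le n hn
  have e : gg x / (x / n) = n * (gg x / x) := by field_simp
  rw [e] at h3
  linarith

lemma PP_lower {δ X : ℝ} (hδ : 0 < δ) {r : ℕ} (hr : 1 ≤ r)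
    (hX : ∀ s ∈ Icc δ X, s ≤ ((1 + δ) * W0 s) * MM r ((1 + δ) * W0 s))
    (n : ℕ) (hn : 1 ≤ n) {x : ℝ} (hx : 0 < x) (hxn : x ≤ n) (hrx : r * x ≤ δ * n)
    (hxX : x + δ ≤ X) :
    n * (Psi x + x / 2 - gg δ / x - Real.log (1 + δ)) - (r * GG δ + Real.log r.factorial) ≤
      Real.log (PP r n (x / n)) := by
  have hn0 : (0 : ℝ) < n := by exact_mod_cast hn
  have hy : 0 < x / n := by positivity
  have exn : (n : ℝ) * (x / n) = x := by field_simp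
  have h := aa_lower hδ hr hX hy ((div_le_one hn0).2 hxn)
    (by rw [← mul_div_assoc, div_le_iff₀ hn0]; exact hrx) n (by rwa [exn])
  have h3 := Real.log_le_log (by positivity) h
  rw [exn, Real.log_mul (by positivity) (by positivity), Real.log_div (by positivity)
    (by positivity), Real.log_exp, Real.log_exp] at h3
  rw [log_PP r n hr hn hx, Psi_eq hx]
  have h4 := log_fact_ge n hn
  have h5 : n * ((gg x - gg δ) / x) ≤ (gg (x + δ) - gg δ) / (x / n) := by
    have e : (gg (x + δ) - gg δ) / (x / n) = n * ((gg (x + δ) - gg δ) / x) := by field_simp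
    rw [e]
    have := gg_mono hx (show x ≤ x + δ by linarith)
    gcongr
  have e : (n : ℝ) * ((gg x - gg δ) / x) = n * (gg x / x) - n * (gg δ / x) := by ring
  rw [e] at h5
  linarith

end RC

namespace RC
open SimpleGraph

lemma edges_le (n : ℕ) (G : SimpleGraph (Fin n)) : G.edgeSet.ncard ≤ n * (n - 1) / 2 := by
  classical
  have h := G.card_edgeFinset_le_card_choose_two
  rw [Fintype.card_fin, Nat.choose_two_right] at h
  rwa [← coe_edgeFinset, ncard_coe_finset]

open Classical in
lemma ZP_sum (n : ℕ) (p q : ℝ) (A : Set (SimpleGraph (Fin n))) :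
    ZP n p q A = ∑ G with G ∈ A, rcW n p q G := by
  unfold ZP
  have h : A = ((Finset.univ.filter (fun G => G ∈ A) : Finset _) : Set (SimpleGraph (Fin n))) := by
    ext G; simp
  conv_lhs => rw [h]
  rw [finsum_mem_coe_finset]

lemma rcW_nonneg (n : ℕ) {p q : ℝ} (hp : 0 ≤ p) (hp1 : p ≤ 1) (hq : 0 ≤ q)
    (G : SimpleGraph (Fin n)) : 0 ≤ rcW n p q G := by
  unfold rcW
  have : 0 ≤ 1 - p := by linarith
  positivity

lemma ZP_mono (n : ℕ) {p q : ℝ} (hp : 0 ≤ p) (hp1 : p ≤ 1) (hq : 0 ≤ q)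
    {A B : Set (SimpleGraph (Fin n))} (h : A ⊆ B) : ZP n p q A ≤ ZP n p q B := by
  classical
  rw [ZP_sum, ZP_sum]
  refine Finset.sum_le_sum_of_subset_of_nonneg ?_ (fun G _ _ => rcW_nonneg n hp hp1 hq G)
  intro G
  simp only [Finset.mem_filter, Finset.mem_univ, true_and]
  exact fun hG => h hG

/-- forests with components bounded by `r` -/
def FF (r n : ℕ) : Set (SimpleGraph (Fin n)) :=
  {G | G.IsAcyclic ∧ ∀ v, (G.connectedComponentMk v).supp.ncard ≤ r}

lemma FF_sub_L (r n : ℕ) : FF r n ⊆ Lev n := fun _ h => h.1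

lemma FF_sub_B (r n : ℕ) : FF r n ⊆ Bev n r := fun G h v => by
  have := h.2 v
  unfold compSize
  exact_mod_cast this

lemma FF_full (n : ℕ) : FF n n = Lev n := by
  refine Subset.antisymm (FF_sub_L n n) (fun G h => ⟨h, fun v => ?_⟩)
  have := ncard_le_card (G.connectedComponentMk v).supp
  simpa using this

lemma ZP_FF (r n : ℕ) {p q : ℝ} (hp1 : p < 1) (hq : 0 < q) :
    ZP n p q (FF r n) = q ^ n * (1 - p) ^ (n * (n - 1) / 2) * PP r n (p / ((1 - p) * q)) := by
  have h0 : 0 < 1 - p := by linarith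
  unfold ZP PP FS
  have i1 : Fintype (FO r (Fin n)) := Fintype.ofFinite _
  rw [← finsum_set_coe_eq_finsum_mem]
  change (∑ᶠ G : FO r (Fin n), rcW n p q G.1) = _
  rw [finsum_eq_sum_of_fintype, finsum_eq_sum_of_fintype, Finset.mul_sum]
  refine Finset.sum_congr rfl (fun G _ => ?_)
  obtain ⟨G, hG⟩ := G
  have h1 := forest_card n (Fin n) (by simp) G hG.1
  have h2 := edges_le n G
  simp only
  unfold rcW
  obtain ⟨d, hd⟩ := Nat.exists_eq_add_of_le h2
  rw [hd, Nat.add_sub_cancel_left]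
  have h3 : q ^ n = q ^ G.edgeSet.ncard * q ^ Nat.card G.ConnectedComponent := by
    rw [← pow_add, h1]
  rw [h3, pow_add, div_pow, mul_pow]
  field_simp

lemma PP_mono (r n : ℕ) {y z : ℝ} (hy : 0 ≤ y) (h : y ≤ z) : PP r n y ≤ PP r n z := by
  have i1 : Fintype (FO r (Fin n)) := Fintype.ofFinite _
  rw [PP, FS, finsum_eq_sum_of_fintype, PP, FS, finsum_eq_sum_of_fintype]
  exact Finset.sum_le_sum (fun G _ => pow_le_pow_left₀ hy h _)

lemma PP_scale (r n : ℕ) {y c : ℝ} (hy : 0 ≤ y) (hc : 1 ≤ c) : PP r n (c * y) ≤ c ^ n * PP r n y := by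
  have i1 : Fintype (FO r (Fin n)) := Fintype.ofFinite _
  rw [PP, FS, finsum_eq_sum_of_fintype, PP, FS, finsum_eq_sum_of_fintype, Finset.mul_sum]
  refine Finset.sum_le_sum (fun G _ => ?_)
  rw [mul_pow]
  have h1 := forest_card n (Fin n) (by simp) G.1 G.2.1
  exact mul_le_mul_of_nonneg_right (pow_le_pow_right₀ hc (by omega)) (by positivity)

open Classical in
/-- pairs inside the components of `F` -/
def inPairs {n : ℕ} (F : SimpleGraph (Fin n)) : Finset (Sym2 (Fin n)) :=
  (Finset.univ.filter (fun p : Fin n × Fin n => F.Reachable p.1 p.2)).image (fun p => s(p.1, p.2))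

lemma inPairs_card {n r : ℕ} (F : SimpleGraph (Fin n))
    (h : ∀ v, (F.connectedComponentMk v).supp.ncard ≤ r) : (inPairs F).card ≤ n * r := by
  classical
  refine Finset.card_image_le.trans ?_
  rw [Finset.card_filter, ← Finset.univ_product_univ, Finset.sum_product]
  have : ∀ a : Fin n, ∑ b : Fin n, (if F.Reachable a b then 1 else 0) ≤ r := by
    intro a
    refine le_trans (le_of_eq ?_) (h a)
    rw [← Finset.card_filter, ← ncard_coe_finset]
    congr 1
    ext b
    simp [ConnectedComponent.mem_supp_iff, ConnectedComponent.eq, reachable_comm]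
  refine (Finset.sum_le_sum (fun a _ => this a)).trans ?_
  simp

lemma comp_card_eq {n : ℕ} {F G : SimpleGraph (Fin n)} (h : F.Reachable = G.Reachable) :
    Nat.card F.ConnectedComponent = Nat.card G.ConnectedComponent := by
  unfold ConnectedComponent
  rw [h]

lemma comp_supp_eq {n : ℕ} {F G : SimpleGraph (Fin n)} (h : F.Reachable = G.Reachable) (v : Fin n) :
    (F.connectedComponentMk v).supp = (G.connectedComponentMk v).supp := by
  ext w
  simp only [ConnectedComponent.mem_supp_iff, ConnectedComponent.eq, h]

open Classical in
lemma fiber_bound (r n : ℕ) {p q : ℝ} (hp : 0 < p) (hp1 : p < 1) (hq : 0 < q)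
    (F : SimpleGraph (Fin n)) (hF : F ∈ FF r n) :
    ∑ G with F ≤ G ∧ F.Reachable = G.Reachable, rcW n p q G ≤
      ((1 - p)⁻¹) ^ (n * r) * rcW n p q F := by
  have h0 : 0 < 1 - p := by linarith
  set t := p / (1 - p) with ht
  have ht0 : 0 < t := by positivity
  have hw : ∀ G : SimpleGraph (Fin n), F ≤ G → F.Reachable = G.Reachable →
      rcW n p q G = rcW n p q F * t ^ (G.edgeFinset \ F.edgeFinset).card := by
    intro G hFG hR
    have hsub : F.edgeFinset ⊆ G.edgeFinset := edgeFinset_mono hFG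
    have hc := Finset.card_sdiff_add_card_eq_card hsub
    have e1 : F.edgeSet.ncard = F.edgeFinset.card := by rw [← coe_edgeFinset, ncard_coe_finset]
    have e2 : G.edgeSet.ncard = G.edgeFinset.card := by rw [← coe_edgeFinset, ncard_coe_finset]
    unfold rcW
    have h1 := edges_le n G
    rw [comp_card_eq hR]
    obtain ⟨d, hd⟩ := Nat.exists_eq_add_of_le h1
    rw [hd, Nat.add_sub_cancel_left, e1, e2, ← hc]
    rw [show (G.edgeFinset \ F.edgeFinset).card + F.edgeFinset.card + d - F.edgeFinset.card =
      (G.edgeFinset \ F.edgeFinset).card + d by omega]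
    rw [pow_add, pow_add, ht, div_pow]
    field_simp
  rw [Finset.sum_congr rfl (g := fun G => rcW n p q F * t ^ (G.edgeFinset \ F.edgeFinset).card)]
  swap
  · intro G hG
    simp only [Finset.mem_filter, Finset.mem_univ, true_and] at hG
    exact hw G hG.1 hG.2
  rw [← Finset.mul_sum, mul_comm]
  refine mul_le_mul_of_nonneg_right ?_ (rcW_nonneg n hp.le hp1.le hq.le F)
  have h3 : ∑ G with F ≤ G ∧ F.Reachable = G.Reachable, t ^ (G.edgeFinset \ F.edgeFinset).card ≤
      ∑ H ∈ (inPairs F).powerset, t ^ H.card := by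
    rw [← Finset.sum_image (f := fun H : Finset (Sym2 (Fin n)) => t ^ H.card)
      (g := fun G : SimpleGraph (Fin n) => G.edgeFinset \ F.edgeFinset)]
    · refine Finset.sum_le_sum_of_subset_of_nonneg ?_ (fun H _ _ => by positivity)
      intro H hH
      simp only [Finset.mem_image, Finset.mem_filter, Finset.mem_univ, true_and] at hH
      obtain ⟨G, ⟨hFG, hR⟩, rfl⟩ := hH
      rw [Finset.mem_powerset]
      intro e he
      have he' : e ∈ G.edgeSet := by
        have := (Finset.mem_sdiff.1 he).1
        simpa using this
      induction e using Sym2.ind with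
      | _ a b =>
        unfold inPairs
        rw [Finset.mem_image]
        refine ⟨(a, b), ?_, rfl⟩
        simp only [Finset.mem_filter, Finset.mem_univ, true_and]
        rw [hR]
        exact Adj.reachable he'
    · intro G hG G' hG' heq
      simp only [Finset.coe_filter, Finset.mem_univ, true_and, mem_setOf_eq] at hG hG'
      have h1 : F.edgeFinset ⊆ G.edgeFinset := edgeFinset_mono hG.1
      have h2 : F.edgeFinset ⊆ G'.edgeFinset := edgeFinset_mono hG'.1
      simp only at heq
      have : G.edgeFinset = G'.edgeFinset := by
        rw [← Finset.sdiff_union_of_subset h1, ← Finset.sdiff_union_of_subset h2, heq]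
      exact edgeFinset_inj.1 this
  refine h3.trans ?_
  have h4 := Finset.sum_pow_mul_eq_add_pow t 1 (inPairs F)
  simp only [one_pow, mul_one] at h4
  rw [h4]
  have h5 : t + 1 = (1 - p)⁻¹ := by rw [ht]; field_simp; ring
  rw [h5]
  refine pow_le_pow_right₀ ?_ (inPairs_card F hF.2)
  rw [← h5]; linarith

lemma ZB_le (r n : ℕ) {p q : ℝ} (hp : 0 < p) (hp1 : p < 1) (hq : 0 < q) :
    ZP n p q (Bev n r) ≤ ((1 - p)⁻¹) ^ (n * r) * ZP n p q (FF r n) := by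
  classical
  choose f hf1 hf2 hf3 using fun G : SimpleGraph (Fin n) => G.exists_isAcyclic_reachable_eq_le
  rw [ZP_sum, ZP_sum, Finset.mul_sum]
  rw [← Finset.sum_fiberwise_of_maps_to (s := Finset.univ.filter (fun G => G ∈ Bev n r))
    (t := Finset.univ.filter (fun G => G ∈ FF r n)) (g := f)]
  · refine Finset.sum_le_sum (fun F hF => ?_)
    simp only [Finset.mem_filter, Finset.mem_univ, true_and] at hF
    refine le_trans ?_ (fiber_bound r n hp hp1 hq F hF)
    refine Finset.sum_le_sum_of_subset_of_nonneg ?_ (fun G _ _ => rcW_nonneg n hp.le hp1.le hq.le G)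
    intro G hG
    simp only [Finset.mem_filter, Finset.mem_univ, true_and] at hG ⊢
    obtain ⟨_, rfl⟩ := hG
    exact ⟨hf1 G, hf3 G⟩
  · intro G hG
    simp only [Finset.mem_filter, Finset.mem_univ, true_and] at hG ⊢
    refine ⟨hf2 G, fun v => ?_⟩
    rw [comp_supp_eq (hf3 G)]
    have := hG v
    unfold compSize at this
    exact_mod_cast this

end RC

namespace RC

def LL (q l : ℝ) : ℝ := Psi (l / q) - ((q - 1) / (2 * q)) * l + Real.log q

lemma LL_eq {q : ℝ} (hq : 0 < q) (l : ℝ) :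
    LL q l = Real.log q - l / 2 + (Psi (l / q) + (l / q) / 2) := by
  unfold LL; field_simp; ring

lemma NN_cast (n : ℕ) : ((n * (n - 1) / 2 : ℕ) : ℝ) = n * (n - 1) / 2 := by
  rw [← Nat.choose_two_right, Nat.cast_choose_two]

lemma log_one_sub_ge {p : ℝ} (hp : 0 ≤ p) (hp2 : p ≤ 1 / 2) : -(p + 2 * p ^ 2) ≤ Real.log (1 - p) := by
  have h0 : 0 < 1 - p := by linarith
  have h := Real.one_sub_inv_le_log_of_pos h0
  refine le_trans ?_ h
  have : (1 - p)⁻¹ ≤ 1 + p + 2 * p ^ 2 := by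
    rw [inv_le_iff_one_le_mul₀ h0]
    have : 0 ≤ p ^ 2 * (1 - 2 * p) := mul_nonneg (sq_nonneg p) (by linarith)
    nlinarith
  linarith

/-- logarithm of the forest partition function -/
lemma log_ZFF (r n : ℕ) (hr : 1 ≤ r) {p q : ℝ} (hp : 0 < p) (hp1 : p < 1) (hq : 0 < q) :
    0 < ZP n p q (FF r n) ∧ Real.log (ZP n p q (FF r n)) = n * Real.log q +
      (n * (n - 1) / 2) * Real.log (1 - p) + Real.log (PP r n (p / ((1 - p) * q))) := by
  have h0 : 0 < 1 - p := by linarith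
  have hy : 0 < p / ((1 - p) * q) := by positivity
  have h1 : 0 < PP r n (p / ((1 - p) * q)) := one_pos.trans_le (one_le_PP r n hr hy.le)
  rw [ZP_FF r n hp1 hq]
  refine ⟨by positivity, ?_⟩
  rw [Real.log_mul (by positivity) h1.ne', Real.log_mul (by positivity) (by positivity),
    Real.log_pow, Real.log_pow, NN_cast]

lemma FF_lower {q l δ X : ℝ} (hq : 0 < q) (hl : 0 < l) (hδ : 0 < δ) {r : ℕ} (hr : 1 ≤ r)
    (hX : ∀ s ∈ Icc δ X, s ≤ ((1 + δ) * W0 s) * MM r ((1 + δ) * W0 s))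
    (n : ℕ) (hn : 1 ≤ n) (hln : 2 * l ≤ n) (hxn : l / q ≤ n) (hrx : r * (l / q) ≤ δ * n)
    (hxX : l / q + δ ≤ X) :
    n * (LL q l - gg δ / (l / q) - Real.log (1 + δ)) - l ^ 2 - (r * GG δ + Real.log r.factorial) ≤
      Real.log (ZP n (l / n) q (FF r n)) := by
  have hn0 : (0 : ℝ) < n := by exact_mod_cast hn
  have hn1 : (1 : ℝ) ≤ n := by exact_mod_cast hn
  have hp : 0 < l / n := by positivity
  have hp2 : l / n ≤ 1 / 2 := by rw [div_le_iff₀ hn0]; linarith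
  have hp1 : l / n < 1 := by linarith
  have h0 : 0 < 1 - l / n := by linarith
  rw [(log_ZFF r n hr hp hp1 hq).2]
  have h1 := PP_lower hδ hr hX n hn (div_pos hl hq) hxn hrx hxX
  have h2 : PP r n (l / q / n) ≤ PP r n (l / n / ((1 - l / n) * q)) := by
    apply PP_mono _ _ (by positivity)
    rw [div_div, div_div, mul_comm q]
    apply div_le_div_of_nonneg_left hl.le (by positivity)
    have : (1 - l / n) * q ≤ q := by nlinarith
    exact mul_le_mul_of_nonneg_left this hn0.le
  have h3 := Real.log_le_log (one_pos.trans_le (one_le_PP r n hr (by positivity))) h2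
  have h4 := log_one_sub_ge hp.le hp2
  have h5 : -(n * l / 2) - l ^ 2 ≤ (n * (n - 1) / 2 : ℝ) * Real.log (1 - l / n) := by
    have a1 : 0 ≤ (n * (n - 1) / 2 : ℝ) := by
      have : (0 : ℝ) ≤ n - 1 := by linarith
      positivity
    refine le_trans ?_ (mul_le_mul_of_nonneg_left h4 a1)
    have a2 : 0 ≤ l / n + 2 * (l / n) ^ 2 := by positivity
    have a3 : (n * (n - 1) / 2 : ℝ) ≤ n ^ 2 / 2 := by nlinarith
    have a4 := mul_le_mul_of_nonneg_right a3 a2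
    have a5 : (n : ℝ) ^ 2 / 2 * (l / n + 2 * (l / n) ^ 2) = n * l / 2 + l ^ 2 := by
      field_simp
    rw [a5] at a4
    linarith
  rw [LL_eq hq]
  linarith

lemma FF_upper {q l : ℝ} (hq : 0 < q) (hl : 0 < l) {r : ℕ} (hr : 1 ≤ r)
    (n : ℕ) (hn : 1 ≤ n) (hln : 2 * l ≤ n) :
    Real.log (ZP n (l / n) q (FF r n)) ≤
      n * LL q l + (l + 2 * l ^ 2) + l / 2 + Real.log n + 1 := by
  have hn0 : (0 : ℝ) < n := by exact_mod_cast hn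
  have hn1 : (1 : ℝ) ≤ n := by exact_mod_cast hn
  have hp : 0 < l / n := by positivity
  have hp2 : l / n ≤ 1 / 2 := by rw [div_le_iff₀ hn0]; linarith
  have hp1 : l / n < 1 := by linarith
  have h0 : 0 < 1 - l / n := by linarith
  rw [(log_ZFF r n hr hp hp1 hq).2]
  have h1 := PP_upper r n hr hn (div_pos hl hq)
  have hc : 1 ≤ (1 - l / n)⁻¹ := (one_le_inv₀ h0).2 (by linarith)
  have h2 := PP_scale r n (y := l / q / n) (by positivity) hc
  have e1 : (1 - l / n)⁻¹ * (l / q / n) = l / n / ((1 - l / n) * q) := by field_simp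
  rw [e1] at h2
  have h3 := Real.log_le_log (one_pos.trans_le (one_le_PP r n hr (by positivity))) h2
  rw [Real.log_mul (by positivity)
    (one_pos.trans_le (one_le_PP r n hr (by positivity))).ne', Real.log_pow, Real.log_inv] at h3
  have h4 := log_one_sub_ge hp.le hp2
  have h5 : (n * (n - 1) / 2 : ℝ) * Real.log (1 - l / n) ≤ -(n * l / 2) + l / 2 := by
    have a0 := Real.log_le_sub_one_of_pos h0
    have a1 : 0 ≤ (n * (n - 1) / 2 : ℝ) := by
      have : (0 : ℝ) ≤ n - 1 := by linarith
      positivity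
    refine (mul_le_mul_of_nonneg_left a0 a1).trans (le_of_eq ?_)
    field_simp
    ring
  have h6 : (n : ℝ) * -Real.log (1 - l / n) ≤ l + 2 * l ^ 2 := by
    have a1 : (n : ℝ) * -Real.log (1 - l / n) ≤ n * (l / n + 2 * (l / n) ^ 2) :=
      mul_le_mul_of_nonneg_left (by linarith) hn0.le
    refine a1.trans ?_
    have a2 : (n : ℝ) * (l / n + 2 * (l / n) ^ 2) = l + 2 * l ^ 2 / n := by field_simp
    rw [a2]
    have : 2 * l ^ 2 / n ≤ 2 * l ^ 2 := div_le_self (by positivity) hn1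
    linarith
  rw [LL_eq hq]
  linarith

lemma B_upper {q l : ℝ} (hq : 0 < q) (hl : 0 < l) {r : ℕ} (hr : 1 ≤ r)
    (n : ℕ) (hn : 1 ≤ n) (hln : 2 * l ≤ n) :
    Real.log (ZP n (l / n) q (Bev n r)) ≤
      n * LL q l + (r + 1) * (l + 2 * l ^ 2) + l / 2 + Real.log n + 1 := by
  have hn0 : (0 : ℝ) < n := by exact_mod_cast hn
  have hn1 : (1 : ℝ) ≤ n := by exact_mod_cast hn
  have hp : 0 < l / n := by positivity
  have hp2 : l / n ≤ 1 / 2 := by rw [div_le_iff₀ hn0]; linarith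
  have hp1 : l / n < 1 := by linarith
  have h0 : 0 < 1 - l / n := by linarith
  have hpos := (log_ZFF r n hr hp hp1 hq).1
  have hB := hpos.trans_le (ZP_mono n hp.le hp1.le hq.le (FF_sub_B r n))
  have h1 := Real.log_le_log hB (ZB_le r n hp hp1 hq)
  rw [Real.log_mul (by positivity) hpos.ne', Real.log_pow, Real.log_inv] at h1
  have h2 := FF_upper hq hl hr n hn hln
  have h4 := log_one_sub_ge hp.le hp2
  have h6 : (n : ℝ) * -Real.log (1 - l / n) ≤ l + 2 * l ^ 2 := by
    have a1 : (n : ℝ) * -Real.log (1 - l / n) ≤ n * (l / n + 2 * (l / n) ^ 2) :=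
      mul_le_mul_of_nonneg_left (by linarith) hn0.le
    refine a1.trans ?_
    have a2 : (n : ℝ) * (l / n + 2 * (l / n) ^ 2) = l + 2 * l ^ 2 / n := by field_simp
    rw [a2]
    have : 2 * l ^ 2 / n ≤ 2 * l ^ 2 := div_le_self (by positivity) hn1
    linarith
  have h7 := mul_le_mul_of_nonneg_left h6 (Nat.cast_nonneg r : (0 : ℝ) ≤ r)
  push_cast at h1
  linarith

lemma log_small (D : ℝ) {ε : ℝ} (hε : 0 < ε) : ∀ᶠ n : ℕ in atTop, D + Real.log n ≤ ε * n := by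
  have h : (fun x : ℝ => D + Real.log x) =o[atTop] (fun x : ℝ => x) :=
    (Asymptotics.isLittleO_const_id_atTop D).add Real.isLittleO_log_id_atTop
  have h2 := tendsto_natCast_atTop_atTop.eventually (h.def hε)
  filter_upwards [h2] with n hn
  rw [Real.norm_of_nonneg (Nat.cast_nonneg n)] at hn
  exact (le_abs_self _).trans hn

lemma main {q c1 c2 ε : ℝ} (hq : 0 < q) (h1 : 0 < c1) (h12 : c1 ≤ c2) (hε : 0 < ε) :
    ∀ᶠ r : ℕ in atTop, ∀ᶠ n : ℕ in atTop, ∀ l ∈ Icc c1 c2,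
      |(1 / (n : ℝ)) * Real.log (Zrc n l q (Bev n r)) - LL q l| ≤ ε ∧
      |(1 / (n : ℝ)) * Real.log (Zrc n l q (Lev n)) - LL q l| ≤ ε := by
  have h2 : 0 < c2 := h1.trans_le h12
  obtain ⟨δ, hδ1, hδ2, hδ⟩ : ∃ δ : ℝ, gg δ ≤ ε / 4 * (c1 / q) ∧ δ ≤ ε / 4 ∧ 0 < δ := by
    have a1 : ∀ᶠ δ in 𝓝[>] (0 : ℝ), gg δ < ε / 4 * (c1 / q) :=
      gg_tendsto.eventually (Iio_mem_nhds (by positivity))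
    have a2 : ∀ᶠ δ in 𝓝[>] (0 : ℝ), δ < ε / 4 :=
      mem_nhdsWithin_of_mem_nhds (Iio_mem_nhds (by positivity))
    obtain ⟨δ, b1, b2, b3⟩ := (a1.and (a2.and self_mem_nhdsWithin)).exists
    exact ⟨δ, b1.le, b2.le, b3⟩
  obtain ⟨r0, hr0⟩ := MM_unif hδ (c2 / q + δ)
  filter_upwards [eventually_ge_atTop r0, eventually_ge_atTop 1] with r hr hr1
  have hX := hr0 r hr
  have t := tendsto_natCast_atTop_atTop (R := ℝ)
  filter_upwards [eventually_ge_atTop 1, t.eventually_ge_atTop (2 * c2),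
    t.eventually_ge_atTop (c2 / q), t.eventually_ge_atTop (r * (c2 / q) / δ),
    log_small (c2 ^ 2 + (r * GG δ + Real.log r.factorial)) (ε := ε / 2) (by positivity),
    log_small ((r + 1) * (c2 + 2 * c2 ^ 2) + c2 / 2 + 1) hε] with n hn hn2 hn3 hn4 hn5 hn6
  rintro l ⟨hl1, hl2⟩
  have hl : 0 < l := h1.trans_le hl1
  have hn0 : (0 : ℝ) < n := by exact_mod_cast hn
  have hlog : 0 ≤ Real.log n := Real.log_natCast_nonneg n
  have hp : 0 < l / n := by positivity
  have hp1 : l / n < 1 := by rw [div_lt_one hn0]; linarith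
  have hxx : l / q ≤ c2 / q := by gcongr
  have hlow := FF_lower hq hl hδ hr1 hX n hn (by linarith) (hxx.trans hn3) (by
    rw [div_le_iff₀ hδ] at hn4
    have : r * (l / q) ≤ r * (c2 / q) := by gcongr
    linarith) (by linarith)
  have hL : n * (LL q l - ε) ≤ Real.log (ZP n (l / n) q (FF r n)) := by
    refine le_trans ?_ hlow
    have b1 : gg δ / (l / q) ≤ ε / 4 := by
      rw [div_le_iff₀ (by positivity)]
      refine hδ1.trans ?_
      gcongr
    have b2 : Real.log (1 + δ) ≤ ε / 4 := by
      have := Real.log_le_sub_one_of_pos (show 0 < 1 + δ by linarith)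
      linarith
    have b3 : l ^ 2 ≤ c2 ^ 2 := by gcongr
    have b4 : (n : ℝ) * (LL q l - ε / 2) ≤ n * (LL q l - gg δ / (l / q) - Real.log (1 + δ)) :=
      mul_le_mul_of_nonneg_left (by linarith) hn0.le
    linarith
  have hpos := (log_ZFF r n hr1 hp hp1 hq).1
  have hBl := Real.log_le_log hpos (ZP_mono n hp.le hp1.le hq.le (FF_sub_B r n))
  have hLl := Real.log_le_log hpos (ZP_mono n hp.le hp1.le hq.le (FF_sub_L r n))
  have hBu := B_upper hq hl hr1 n hn (by linarith)
  have hLu := FF_upper hq hl hn n hn (by linarith)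
  rw [FF_full] at hLu
  have hr' : (0 : ℝ) ≤ r := Nat.cast_nonneg r
  have b5 : l + 2 * l ^ 2 ≤ c2 + 2 * c2 ^ 2 := by gcongr
  have b6 : (r + 1) * (l + 2 * l ^ 2) ≤ (r + 1) * (c2 + 2 * c2 ^ 2) := by gcongr
  have b7 : (l + 2 * l ^ 2) ≤ (r + 1) * (l + 2 * l ^ 2) :=
    le_mul_of_one_le_left (by positivity) (by linarith)
  have key : ∀ z : ℝ, n * (LL q l - ε) ≤ z → z ≤ n * (LL q l + ε) →
      |(1 / (n : ℝ)) * z - LL q l| ≤ ε := by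
    intro z hz1 hz2
    rw [one_div, inv_mul_eq_div, abs_le]
    rw [mul_comm] at hz1 hz2
    rw [← le_div_iff₀ hn0] at hz1
    rw [← div_le_iff₀ hn0] at hz2
    constructor <;> linarith
  unfold Zrc
  exact ⟨key _ (hL.trans hBl) (by linarith), key _ (hL.trans hLl) (by linarith)⟩

lemma limsup_near {f : ℕ → ℝ} {L ε : ℝ} (h : ∀ᶠ n in atTop, |f n - L| ≤ ε) :
    |liminf f atTop - L| ≤ ε ∧ |limsup f atTop - L| ≤ ε := by
  have h1 : ∀ᶠ n in atTop, L - ε ≤ f n := h.mono (fun n hn => by have := (abs_le.1 hn).1; linarith)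
  have h2 : ∀ᶠ n in atTop, f n ≤ L + ε := h.mono (fun n hn => by have := (abs_le.1 hn).2; linarith)
  have b1 : IsBoundedUnder (· ≥ ·) atTop f := ⟨_, h1⟩
  have b2 : IsBoundedUnder (· ≤ ·) atTop f := ⟨_, h2⟩
  have a1 : L - ε ≤ liminf f atTop := le_liminf_of_le b2.isCoboundedUnder_ge h1
  have a2 : limsup f atTop ≤ L + ε := limsup_le_of_le b1.isCoboundedUnder_le h2
  have a3 := liminf_le_limsup b2 b1
  constructor <;> rw [abs_le] <;> constructor <;> linarith

lemma unif {q c1 c2 : ℝ} (hq : 0 < q) (h1 : 0 < c1) (h12 : c1 ≤ c2) {C : Set ℝ} (hC : C ⊆ Icc c1 c2) :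
    (TendstoUniformlyOn (fun (r : ℕ) (l : ℝ) =>
          Filter.liminf (fun n : ℕ => (1 / (n:ℝ)) * Real.log (Zrc n l q (Bev n r))) atTop)
        (fun l => Psi (l / q) - ((q - 1) / (2 * q)) * l + Real.log q) atTop C) ∧
      (TendstoUniformlyOn (fun (r : ℕ) (l : ℝ) =>
          Filter.limsup (fun n : ℕ => (1 / (n:ℝ)) * Real.log (Zrc n l q (Bev n r))) atTop)
        (fun l => Psi (l / q) - ((q - 1) / (2 * q)) * l + Real.log q) atTop C) ∧
      TendstoUniformlyOn
        (fun (n : ℕ) (l : ℝ) => (1 / (n:ℝ)) * Real.log (Zrc n l q (Lev n)))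
        (fun l => Psi (l / q) - ((q - 1) / (2 * q)) * l + Real.log q) atTop C := by
  refine ⟨?_, ?_, ?_⟩ <;> rw [Metric.tendstoUniformlyOn_iff] <;> intro ε hε
  · filter_upwards [main hq h1 h12 (half_pos hε)] with r hr l hl
    rw [dist_comm, Real.dist_eq]
    exact ((limsup_near (hr.mono (fun n hn => (hn l (hC hl)).1))).1).trans_lt (half_lt_self hε)
  · filter_upwards [main hq h1 h12 (half_pos hε)] with r hr l hl
    rw [dist_comm, Real.dist_eq]
    exact ((limsup_near (hr.mono (fun n hn => (hn l (hC hl)).1))).2).trans_lt (half_lt_self hε)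
  · obtain ⟨r, hr⟩ := (main hq h1 h12 (half_pos hε)).exists
    filter_upwards [hr] with n hn l hl
    rw [dist_comm, Real.dist_eq]
    exact ((hn l (hC hl)).2).trans_lt (half_lt_self hε)

end RC

/-- Fix `q > 0` and `λ > 0` with `λ ≠ q`. Then
`lim_{r→∞} liminf_{n→∞} (1/n) log Z_{n,λ,q}[B_r]
  = lim_{r→∞} limsup_{n→∞} (1/n) log Z_{n,λ,q}[B_r]
  = lim_{n→∞} (1/n) log Z_{n,λ,q}[L] = Ψ(λ/q) − ((q−1)/(2q))λ + log q`,
and the convergence is uniform for `λ` in compact subsets of `(0,∞) ∖ {q}`. -/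
theorem stmt4 (q lam : ℝ) (hq : 0 < q) (hlam : 0 < lam) (hne : lam ≠ q) :
    (Tendsto (fun r : ℕ =>
        Filter.liminf (fun n : ℕ => (1 / (n:ℝ)) * Real.log (Zrc n lam q (Bev n r))) atTop)
      atTop (𝓝 (Psi (lam / q) - ((q - 1) / (2 * q)) * lam + Real.log q))) ∧
    (Tendsto (fun r : ℕ =>
        Filter.limsup (fun n : ℕ => (1 / (n:ℝ)) * Real.log (Zrc n lam q (Bev n r))) atTop)
      atTop (𝓝 (Psi (lam / q) - ((q - 1) / (2 * q)) * lam + Real.log q))) ∧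
    (Tendsto (fun n : ℕ => (1 / (n:ℝ)) * Real.log (Zrc n lam q (Lev n))) atTop
      (𝓝 (Psi (lam / q) - ((q - 1) / (2 * q)) * lam + Real.log q))) ∧
    ∀ C : Set ℝ, IsCompact C → C ⊆ Set.Ioi (0:ℝ) \ {q} →
      (TendstoUniformlyOn (fun (r : ℕ) (l : ℝ) =>
          Filter.liminf (fun n : ℕ => (1 / (n:ℝ)) * Real.log (Zrc n l q (Bev n r))) atTop)
        (fun l => Psi (l / q) - ((q - 1) / (2 * q)) * l + Real.log q) atTop C) ∧
      (TendstoUniformlyOn (fun (r : ℕ) (l : ℝ) =>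
          Filter.limsup (fun n : ℕ => (1 / (n:ℝ)) * Real.log (Zrc n l q (Bev n r))) atTop)
        (fun l => Psi (l / q) - ((q - 1) / (2 * q)) * l + Real.log q) atTop C) ∧
      TendstoUniformlyOn
        (fun (n : ℕ) (l : ℝ) => (1 / (n:ℝ)) * Real.log (Zrc n l q (Lev n)))
        (fun l => Psi (l / q) - ((q - 1) / (2 * q)) * l + Real.log q) atTop C := by
  have h := RC.unif hq hlam le_rfl (C := {lam}) (by simp)
  have hm : lam ∈ ({lam} : Set ℝ) := rfl
  refine ⟨h.1.tendsto_at hm, h.2.1.tendsto_at hm, h.2.2.tendsto_at hm, ?_⟩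
  intro C hC hsub
  rcases C.eq_empty_or_nonempty with rfl | hne
  · exact RC.unif hq hlam le_rfl (by simp)
  · obtain ⟨a, ha, hmin⟩ := hC.exists_isMinOn hne continuousOn_id
    obtain ⟨b, hb, hmax⟩ := hC.exists_isMaxOn hne continuousOn_id
    exact RC.unif hq (hsub ha).1 (hmin hb) (fun x hx => ⟨hmin hx, hmax hx⟩)
end
end
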